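/- There exists a constant c, depending only on ξ, A, B, such that for every positive integer R, for almost all x ∈ [A,B]: limsup_{N→∞} √N · D_N^{(≤ 2^{-R})}({ξ x^{s_n}}) / √(log log N) ≤ c / R. -/

import Mathlib

open MeasureTheory Filter

/-- The natural logarithm, interpreted as `max {1, log x}`. -/
noncomputable def plog (x : ℝ) : ℝ := max 1 (Real.log x)

/-- The small-interval discrepancy `D_N^{(≤ 2^{-R})}` of the first `N` terms
(indexed `1,…,N`) of `z`. -/
noncomputable def smallDisc (R N : ℕ) (z : ℕ → ℝ) : ℝ :=
  sSup { d : ℝ | ∃ a : ℕ, a < 2 ^ R ∧ ∃ b : ℝ, 0 ≤ b ∧ b ≤ (2 : ℝ) ^ (-(R : ℤ)) ∧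
    d = |(∑ n ∈ Finset.Icc 1 N,
        (Set.indicator (Set.Ico ((a : ℝ) * (2 : ℝ) ^ (-(R : ℤ)))
            ((a : ℝ) * (2 : ℝ) ^ (-(R : ℤ)) + b)) (fun _ => (1 : ℝ)) (z n) - b)) / N| }


/-- periodic primitive facts -/
lemma prim_bound (p : ℝ → ℝ) (hp : Continuous p) (hper : Function.Periodic p 1)
    (hb : ∀ y, |p y| ≤ 1) (hm : ∫ y in (0:ℝ)..1, p y = 0) (t : ℝ) :
    |∫ y in (0:ℝ)..t, p y| ≤ 1 := by
  have hii : ∀ a b, IntervalIntegrable p volume a b := fun a b => hp.intervalIntegrable a b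
  have h1 : ∫ y in (0:ℝ)..(⌊t⌋:ℝ), p y = 0 := by
    have := hper.intervalIntegral_add_zsmul_eq ⌊t⌋ 0 hii
    simp only [zero_add, zsmul_eq_mul, mul_one] at this
    rw [this, hm]; simp
  have h2 : ∫ y in (0:ℝ)..t, p y = ∫ y in (⌊t⌋:ℝ)..t, p y := by
    rw [← intervalIntegral.integral_add_adjacent_intervals (hii 0 ⌊t⌋) (hii ⌊t⌋ t), h1, zero_add]
  rw [h2]
  have := intervalIntegral.norm_integral_le_of_norm_le_const (a := (⌊t⌋:ℝ)) (b := t) (C := 1) (f := p)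
    (fun x _ => hb x)
  rw [Real.norm_eq_abs] at this
  refine this.trans ?_
  have h3 := Int.floor_le t
  have h4 := Int.lt_floor_add_one t
  rw [one_mul, abs_of_nonneg (by linarith)]; linarith

lemma osc (ξ A B : ℝ) (hξ : 0 < ξ) (hA : 1 < A) (hAB : A ≤ B) (s n : ℕ) (hn : 1 ≤ n) (hs : n ≤ s)
    (p : ℝ → ℝ) (hp : Continuous p) (hper : Function.Periodic p 1)
    (hb : ∀ y, |p y| ≤ 1) (hm : ∫ y in (0:ℝ)..1, p y = 0)
    (G G' : ℝ → ℝ) (hG : ∀ x, HasDerivAt G (G' x) x) (hG' : Continuous G')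
    (hG0 : ∀ x, 0 ≤ G x) (η : ℝ) 
    (hη : ∀ x ∈ Set.Icc A B, |G' x| ≤ η * (ξ * (s * x ^ (s-1))) * G x) :
    |∫ x in A..B, G x * p (ξ * x ^ s)| ≤
      (G A + G B) * (A / (ξ * A ^ n)) + (η + A / (ξ * A ^ n)) * ∫ x in A..B, G x := by
  set P : ℝ → ℝ := fun t => ∫ y in (0:ℝ)..t, p y with hP
  have hPd : ∀ t, HasDerivAt P (p t) t := fun t =>
    intervalIntegral.integral_hasDerivAt_right (hp.intervalIntegrable _ _)
      (hp.stronglyMeasurableAtFilter _ _) hp.continuousAt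
  have hPb : ∀ t, |P t| ≤ 1 := prim_bound p hp hper hb hm
  set d : ℝ → ℝ := fun x => ξ * (s * x ^ (s-1)) with hd
  have hs1 : 1 ≤ s := hn.trans hs
  have hsR : (1:ℝ) ≤ s := by exact_mod_cast hs1
  have hdpos : ∀ x, 1 < x → 0 < d x := by
    intro x hx; simp only [hd]; positivity
  have hGc : Continuous G := continuous_iff_continuousAt.2 fun x => (hG x).continuousAt
  -- d x lower bound
  have hAn : 0 < ξ * A ^ n := by positivity
  have hdlow : ∀ x, A ≤ x → 1 / d x ≤ A / (ξ * A ^ n) := by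
    intro x hx
    rw [div_le_div_iff₀ (hdpos x (by linarith)) hAn]
    simp only [hd]
    have h1 : A ^ (s-1) ≤ x ^ (s-1) := by gcongr
    have h2 : A ^ n ≤ A ^ s := by gcongr; linarith
    have h3 : A ^ s = A * A ^ (s-1) := by
      rw [← pow_succ']; congr 1; omega
    have h4 : A ^ (s-1) ≤ s * x ^ (s-1) := by
      have : 0 ≤ x ^ (s-1) := by have : 0 < x := by linarith
                                 positivity
      nlinarith
    have : A ^ n ≤ A * (s * x ^ (s-1)) := by
      rw [h3] at h2
      refine h2.trans ?_
      gcongr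
    nlinarith
  set d' : ℝ → ℝ := fun x => ξ * (s * (((s-1:ℕ):ℝ) * x ^ (s-1-1))) with hd'
  have hdd : ∀ x, HasDerivAt d (d' x) x := by
    intro x
    exact ((hasDerivAt_pow (s-1) x).const_mul (s:ℝ)).const_mul ξ
  set u : ℝ → ℝ := fun x => G x / d x with hu
  set u' : ℝ → ℝ := fun x => (G' x * d x - G x * d' x) / d x ^ 2 with hu'
  have huI : Set.uIcc A B = Set.Icc A B := Set.uIcc_of_le hAB
  have hud : ∀ x ∈ Set.uIcc A B, HasDerivAt u (u' x) x := by
    intro x hx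
    rw [huI] at hx
    exact (hG x).div (hdd x) (hdpos x (by linarith [hx.1])).ne'
  set v : ℝ → ℝ := fun x => P (ξ * x ^ s) with hv
  set v' : ℝ → ℝ := fun x => p (ξ * x ^ s) * d x with hv'
  have hvd : ∀ x ∈ Set.uIcc A B, HasDerivAt v (v' x) x := by
    intro x hx
    have := (hasDerivAt_pow s x).const_mul ξ
    exact (hPd (ξ * x ^ s)).comp x this
  have hdc : Continuous d := by simp only [hd]; fun_prop
  have hd'c : Continuous d' := by simp only [hd']; fun_prop
  have hu'c : ContinuousOn u' (Set.uIcc A B) := by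
    apply ContinuousOn.div
    · exact ((hG'.mul hdc).sub (hGc.mul hd'c)).continuousOn
    · exact (hdc.pow 2).continuousOn
    · intro x hx
      rw [huI] at hx
      have := hdpos x (by linarith [hx.1])
      positivity
  have hv'c : Continuous v' := by simp only [hv']; fun_prop
  have ibp := intervalIntegral.integral_mul_deriv_eq_deriv_mul hud hvd
    hu'c.intervalIntegrable (hv'c.intervalIntegrable _ _)
  have hL : ∫ x in A..B, G x * p (ξ * x ^ s) = ∫ x in A..B, u x * v' x := by
    apply intervalIntegral.integral_congr
    intro x hx
    rw [huI] at hx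
    have := hdpos x (by linarith [hx.1])
    simp only [hu, hv']
    field_simp
  rw [hL, ibp]
  have hu0 : ∀ x ∈ Set.Icc A B, |u x| ≤ G x * (A / (ξ * A ^ n)) := by
    intro x hx
    have h1 := hdpos x (by linarith [hx.1])
    have h2 := hdlow x hx.1
    simp only [hu]
    rw [abs_of_nonneg (div_nonneg (hG0 x) h1.le), div_eq_mul_one_div]
    exact mul_le_mul_of_nonneg_left h2 (hG0 x)
  have hub : ∀ x ∈ Set.Icc A B, |u x * v x| ≤ G x * (A / (ξ * A ^ n)) := by
    intro x hx
    rw [abs_mul]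
    calc |u x| * |v x| ≤ |u x| * 1 := by gcongr; exact hPb _
      _ ≤ _ := by rw [mul_one]; exact hu0 x hx
  have hmain : |∫ x in A..B, u' x * v x| ≤ (η + A / (ξ * A ^ n)) * ∫ x in A..B, G x := by
    rw [← intervalIntegral.integral_const_mul]
    have hcc : Continuous fun x => (η + A / (ξ * A ^ n)) * G x := by fun_prop
    refine intervalIntegral.norm_integral_le_of_norm_le (f := fun x => u' x * v x)
      (g := fun x => (η + A / (ξ * A ^ n)) * G x) hAB ?_ (hcc.intervalIntegrable _ _)
    refine Filter.Eventually.of_forall fun x hx => ?_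
    have hx' : x ∈ Set.Icc A B := ⟨hx.1.le, hx.2⟩
    have hx0 : 0 < x := by linarith [hx.1]
    have hdp := hdpos x (by linarith [hx.1])
    rw [Real.norm_eq_abs, abs_mul]
    have e1 : |u' x| ≤ (η + A / (ξ * A ^ n)) * G x := by
      have e2 : u' x = G' x / d x - G x * (d' x / d x ^ 2) := by
        simp only [hu']; field_simp
      have e3 : |G' x / d x| ≤ η * G x := by
        rw [abs_div, abs_of_pos hdp, div_le_iff₀ hdp]
        have := hη x hx'
        simp only [hd]
        linarith
      have e4 : 0 ≤ d' x := by simp only [hd']; positivity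
      have e5 : d' x / d x ^ 2 ≤ A / (ξ * A ^ n) := by
        rw [div_le_div_iff₀ (by positivity) hAn]
        have f1 : d' x * x = ((s-1:ℕ):ℝ) * d x := by
          simp only [hd', hd]
          rcases Nat.lt_or_ge s 2 with h | h
          · have : s - 1 = 0 := by omega
            simp [this]
          · obtain ⟨k, rfl⟩ : ∃ k, s = k + 2 := ⟨s - 2, by omega⟩
            have : k + 2 - 1 - 1 = k := by omega
            have h' : k + 2 - 1 = k + 1 := by omega
            rw [this, h', pow_succ]
            ring
        have f2 : d x * x = ξ * s * x ^ s := by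
          simp only [hd]
          obtain ⟨k, rfl⟩ : ∃ k, s = k + 1 := ⟨s - 1, by omega⟩
          simp only [Nat.add_sub_cancel]
          rw [pow_succ]; ring
        have f3 : A ^ n ≤ x ^ s := by
          calc A ^ n ≤ A ^ s := by gcongr; linarith
            _ ≤ x ^ s := by have := hx.1.le; gcongr
        have f4 : ((s-1:ℕ):ℝ) ≤ s := by exact_mod_cast Nat.sub_le s 1
        refine le_of_mul_le_mul_right ?_ hx0
        calc d' x * (ξ * A ^ n) * x = (((s-1:ℕ):ℝ) * A ^ n) * (ξ * d x) := by
              rw [← mul_right_comm, f1]; ring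
          _ ≤ (s * x ^ s) * (ξ * d x) := by gcongr
          _ = d x * (d x * x) := by rw [f2]; ring
          _ ≤ A * (d x * (d x * x)) := by
              have : 0 ≤ d x * (d x * x) := by positivity
              nlinarith
          _ = A * d x ^ 2 * x := by ring
      have e6 : |G x * (d' x / d x ^ 2)| ≤ A / (ξ * A ^ n) * G x := by
        rw [abs_of_nonneg (mul_nonneg (hG0 x) (by positivity)), mul_comm]
        exact mul_le_mul_of_nonneg_right e5 (hG0 x)
      rw [e2]
      calc _ ≤ |G' x / d x| + |G x * (d' x / d x ^ 2)| := abs_sub _ _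
        _ ≤ _ := by linarith
    calc |u' x| * |v x| ≤ |u' x| * 1 := by gcongr; exact hPb _
      _ ≤ _ := by rw [mul_one]; exact e1
  have hBB := hub B ⟨hAB, le_rfl⟩
  have hAA := hub A ⟨le_rfl, hAB⟩
  calc |u B * v B - u A * v A - ∫ x in A..B, u' x * v x| 
      ≤ |u B * v B| + |u A * v A| + |∫ x in A..B, u' x * v x| := by
        refine (abs_sub _ _).trans ?_
        gcongr
        exact abs_sub _ _
    _ ≤ _ := by linarith


structure Cls (r : ℕ) (g g' : ℝ → ℝ) : Prop where
  hd : ∀ y, HasDerivAt g (g' y) y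
  hc : Continuous g'
  hb' : ∀ y, |g' y| ≤ 2 * 2 ^ r
  per : Function.Periodic g 1
  hb : ∀ y, |g y| ≤ 1
  hm : ∫ y in (0:ℝ)..1, g y = 0
  hl : ∫ y in (0:ℝ)..1, |g y| ≤ 8 * (1/2) ^ r

lemma Cls.neg {r : ℕ} {g g' : ℝ → ℝ} (h : Cls r g g') : Cls r (fun y => - g y) (fun y => - g' y) where
  hd y := (h.hd y).neg
  hc := h.hc.neg
  hb' y := by rw [abs_neg]; exact h.hb' y
  per y := by show - g (y+1) = - g y; rw [h.per y]
  hb y := by rw [abs_neg]; exact h.hb y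
  hm := by rw [intervalIntegral.integral_neg, h.hm, neg_zero]
  hl := by simp only [abs_neg]; exact h.hl

lemma Cls.cont {r : ℕ} {g g' : ℝ → ℝ} (h : Cls r g g') : Continuous g :=
  continuous_iff_continuousAt.2 fun x => (h.hd x).continuousAt

lemma exp_le_quad (z : ℝ) (hz : |z| ≤ 1) : Real.exp z ≤ 1 + z + z ^ 2 := by
  have := Real.abs_exp_sub_one_sub_id_le hz
  have := (abs_le.1 this).2
  linarith

lemma geom_T (A : ℝ) (hA : 1 < A) (T : Finset ℕ) (n h : ℕ) (hT : ∀ m ∈ T, m + h ≤ n) :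
    ∑ m ∈ T, A ^ m * A ^ h ≤ A / (A - 1) * A ^ n := by
  rcases Nat.lt_or_ge n h with hn | hn
  · have : T = ∅ := by
      rw [Finset.eq_empty_iff_forall_notMem]
      intro m hm
      have := hT m hm; omega
    rw [this]; simp
    have : 0 < A - 1 := by linarith
    positivity
  · have h1 : T ⊆ Finset.range (n - h + 1) := by
      intro m hm
      have := hT m hm
      simp; omega
    have h2 : ∑ m ∈ T, A ^ m * A ^ h ≤ ∑ m ∈ Finset.range (n - h + 1), A ^ m * A ^ h :=
      Finset.sum_le_sum_of_subset_of_nonneg h1 (fun _ _ _ => by positivity)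
    refine h2.trans ?_
    rw [← Finset.sum_mul, geom_sum_eq (by linarith)]
    have h3 : A ^ n = A ^ (n - h) * A ^ h := by rw [← pow_add]; congr 1; omega
    rw [h3, div_mul_eq_mul_div, div_mul_eq_mul_div]
    refine div_le_div_of_nonneg_right ?_ (by linarith)
    rw [pow_succ]
    have : 0 < A ^ h := by positivity
    nlinarith

lemma theta_ratio (A x : ℝ) (hA : 1 < A) (hx : A ≤ x) (s : ℕ → ℕ) (hs : StrictMono s)
    (hs1 : ∀ n, 1 ≤ n → 1 ≤ s n) (m n : ℕ) (hm : 1 ≤ m) (hmn : m < n) :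
    A ^ n * (s m * x ^ (s m - 1)) ≤ A ^ m * (s n * x ^ (s n - 1)) := by
  have h1 : s m + (n - m) ≤ s n := by
    have := hs.add_le_nat (n - m) m
    rw [show n - m + m = n by omega] at this
    omega
  have h2 : A ^ n = A ^ m * A ^ (n - m) := by rw [← pow_add]; congr 1; omega
  have h3 : s n - 1 = (s m - 1) + (s n - s m) := by
    have := hs1 m hm; omega
  have h4 : A ^ (n - m) ≤ x ^ (s n - s m) := by
    calc A ^ (n-m) ≤ A ^ (s n - s m) := pow_le_pow_right₀ hA.le (by omega)
      _ ≤ _ := by gcongr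
  have hx0 : 0 < x := by linarith
  have h5 : (s m : ℝ) ≤ s n := by exact_mod_cast (hs hmn).le
  rw [h2, h3, pow_add, mul_assoc]
  refine mul_le_mul_of_nonneg_left ?_ (by positivity)
  calc A ^ (n-m) * (s m * x ^ (s m - 1)) ≤ x ^ (s n - s m) * (s n * x ^ (s m - 1)) := by gcongr
    _ = _ := by ring

set_option maxHeartbeats 1000000 in
lemma stepE (ξ A B : ℝ) (hξ : 0 < ξ) (hA : 1 < A) (hAB : B - A = 1) (s : ℕ → ℕ) (hs : StrictMono s)
    (hs1 : ∀ n, 1 ≤ n → 1 ≤ s n) (r h : ℕ) (hh : (4:ℝ) ^ r ≤ A ^ h) (hh1 : 1 ≤ h)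
    (g g' : ℝ → ℝ) (hg : Cls r g g') (lam : ℝ) (hl0 : 0 ≤ lam) (hl1 : lam ≤ 1)
    (hlA : Real.exp lam ≤ Real.sqrt A) (T : Finset ℕ) (n : ℕ) (hT1 : ∀ m ∈ T, 1 ≤ m)
    (hT : ∀ m ∈ T, m + h ≤ n) (hn : 1 ≤ n) :
    ∫ x in A..B, Real.exp (lam * (∑ m ∈ T, g (ξ * x ^ s m) + g (ξ * x ^ s n))) ≤
      (1 + (4 * (A / (A - 1)) + 8) * lam ^ 2 * (1/2) ^ r + 4 * A / ξ * (1 / Real.sqrt A) ^ n) *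
        (∫ x in A..B, Real.exp (lam * (∑ m ∈ T, g (ξ * x ^ s m)))) + 
        4 * A / ξ * (1 / Real.sqrt A) ^ n := by
  have hgc := hg.cont
  set G : ℝ → ℝ := fun x => Real.exp (lam * (∑ m ∈ T, g (ξ * x ^ s m))) with hGdef
  set G' : ℝ → ℝ := fun x => G x * (lam * ∑ m ∈ T, g' (ξ * x ^ s m) * (ξ * (s m * x ^ (s m - 1)))) with hG'def
  have hG0 : ∀ x, 0 < G x := fun x => Real.exp_pos _
  have hGc : Continuous G := by simp only [hGdef]; fun_prop
  have hg'c := hg.hc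
  have hG'c : Continuous G' := by simp only [hG'def]; fun_prop
  have hGd : ∀ x, HasDerivAt G (G' x) x := by
    intro x
    have : HasDerivAt (fun x => ∑ m ∈ T, g (ξ * x ^ s m))
        (∑ m ∈ T, g' (ξ * x ^ s m) * (ξ * (s m * x ^ (s m - 1)))) x := by
      apply HasDerivAt.fun_sum
      intro m _
      exact (hg.hd (ξ * x ^ s m)).comp x ((hasDerivAt_pow (s m) x).const_mul ξ)
    exact (this.const_mul lam).exp
  set CA := A / (A - 1) with hCA
  have hCA0 : 0 < CA := by have : 0 < A - 1 := by linarith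
                           positivity
  set η := 2 * lam * (1/2) ^ r * CA with hηdef
  have hη : ∀ x ∈ Set.Icc A B, |G' x| ≤ η * (ξ * (s n * x ^ (s n - 1))) * G x := by
    intro x hx
    have hx0 : 0 < x := by linarith [hx.1]
    simp only [hG'def]
    rw [abs_mul, abs_of_pos (hG0 x), mul_comm (G x)]
    refine mul_le_mul_of_nonneg_right ?_ (hG0 x).le
    rw [abs_mul, abs_of_nonneg hl0]
    have a1 : |∑ m ∈ T, g' (ξ * x ^ s m) * (ξ * (s m * x ^ (s m - 1)))| ≤
        ∑ m ∈ T, 2 * 2 ^ r * (ξ * (s m * x ^ (s m - 1))) := by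
      refine (Finset.abs_sum_le_sum_abs _ _).trans ?_
      apply Finset.sum_le_sum
      intro m _
      rw [abs_mul]
      have : 0 ≤ ξ * (s m * x ^ (s m - 1)) := by positivity
      rw [abs_of_nonneg this]
      exact mul_le_mul_of_nonneg_right (hg.hb' _) this
    set q := (s n : ℝ) * x ^ (s n - 1) with hq
    have hq0 : 0 ≤ q := by positivity
    have a2 : A ^ n * ∑ m ∈ T, (s m : ℝ) * x ^ (s m - 1) ≤ (∑ m ∈ T, A ^ m) * q := by
      rw [Finset.mul_sum, Finset.sum_mul]
      apply Finset.sum_le_sum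
      intro m hm
      exact theta_ratio A x hA hx.1 s hs hs1 m n (hT1 m hm) (by have := hT m hm; omega)
    have a3 := geom_T A hA T n h hT
    rw [← Finset.sum_mul] at a3
    have a4 : (4:ℝ) ^ r * ∑ m ∈ T, (s m : ℝ) * x ^ (s m - 1) ≤ CA * q := by
      set X := ∑ m ∈ T, (s m : ℝ) * x ^ (s m - 1)
      have hX : 0 ≤ X := Finset.sum_nonneg fun m _ => by positivity
      have hAn : 0 < A ^ n := by positivity
      refine le_of_mul_le_mul_left ?_ hAn
      calc A ^ n * (4 ^ r * X) = 4 ^ r * (A ^ n * X) := by ring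
        _ ≤ A ^ h * ((∑ m ∈ T, A ^ m) * q) := by gcongr
        _ = ((∑ m ∈ T, A ^ m) * A ^ h) * q := by ring
        _ ≤ (CA * A ^ n) * q := by gcongr
        _ = _ := by ring
    rw [← Finset.mul_sum, ← Finset.mul_sum] at a1
    have a5 : (2:ℝ) ^ r = (1/2) ^ r * 4 ^ r := by rw [← mul_pow]; norm_num
    calc _ ≤ lam * (2 * 2 ^ r * (ξ * ∑ m ∈ T, (s m : ℝ) * x ^ (s m - 1))) := by gcongr
      _ = 2 * lam * (1/2) ^ r * ξ * (4 ^ r * ∑ m ∈ T, (s m : ℝ) * x ^ (s m - 1)) := by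
          rw [a5]; ring
      _ ≤ 2 * lam * (1/2) ^ r * ξ * (CA * q) := by gcongr
      _ = _ := by rw [hηdef]; ring
  have hsn : n ≤ s n := hs.id_le n
  have hAB' : A ≤ B := by linarith
  set E := ∫ x in A..B, G x with hE
  have hE0 : 0 ≤ E := intervalIntegral.integral_nonneg hAB' fun x _ => (hG0 x).le
  set bn := (1 / Real.sqrt A) ^ n with hbn
  have hsA : 0 < Real.sqrt A := Real.sqrt_pos.2 (by linarith)
  have hbn0 : 0 < bn := by positivity
  have hGb : ∀ x, G x ≤ Real.sqrt A ^ n := by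
    intro x
    have b1 : ∑ m ∈ T, g (ξ * x ^ s m) ≤ n := by
      have b2 : T ⊆ Finset.range n := by
        intro m hm; have := hT m hm; simp; omega
      calc ∑ m ∈ T, g (ξ * x ^ s m) ≤ ∑ m ∈ T, (1:ℝ) :=
            Finset.sum_le_sum fun m _ => (abs_le.1 (hg.hb _)).2
        _ = (T.card : ℝ) := by simp
        _ ≤ n := by have := Finset.card_le_card b2; simp at this; exact_mod_cast this
    calc G x ≤ Real.exp (lam * n) := by
          simp only [hGdef]; gcongr
      _ = Real.exp lam ^ n := by rw [mul_comm, Real.exp_nat_mul]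
      _ ≤ _ := by gcongr
  have hAbn : A / (ξ * A ^ n) = A / ξ * (bn * bn) := by
    have : bn * bn = 1 / A ^ n := by
      rw [hbn, ← mul_pow, div_mul_div_comm, Real.mul_self_sqrt (by linarith)]
      simp
    rw [this]; field_simp
  have hbn1 : bn ≤ 1 := by
    apply pow_le_one₀ (by positivity)
    rw [div_le_one hsA]
    exact Real.one_le_sqrt.2 hA.le
  have key : ∀ p : ℝ → ℝ, Continuous p → Function.Periodic p 1 → (∀ y, |p y| ≤ 1) →
      ∫ y in (0:ℝ)..1, p y = 0 → 
      |∫ x in A..B, G x * p (ξ * x ^ s n)| ≤ 2 * A / ξ * bn + (η + 2 * A / ξ * bn) * E := by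
    intro p h1 h2 h3 h4
    refine (osc ξ A B hξ hA hAB' (s n) n hn hsn p h1 h2 h3 h4 G G' hGd hG'c (fun x => (hG0 x).le) η hη).trans ?_
    have hAξ : 0 < A / ξ := by have : 0 < A := by linarith
                               positivity
    have c1 : Real.sqrt A ^ n * bn = 1 := by
      rw [hbn, ← mul_pow, mul_one_div_cancel hsA.ne', one_pow]
    rw [hAbn]
    have c2 : (G A + G B) * (A / ξ * (bn * bn)) ≤ 2 * A / ξ * bn := by
      calc (G A + G B) * (A / ξ * (bn * bn)) ≤ (Real.sqrt A ^ n + Real.sqrt A ^ n) * (A / ξ * (bn * bn)) := by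
            gcongr <;> exact hGb _
        _ = 2 * (A / ξ) * bn * (Real.sqrt A ^ n * bn) := by ring
        _ = _ := by rw [c1]; ring
    have c3 : A / ξ * (bn * bn) ≤ 2 * A / ξ * bn := by
      have : bn * bn ≤ bn := by nlinarith
      calc A / ξ * (bn * bn) ≤ A / ξ * bn := by gcongr
        _ ≤ 2 * (A / ξ * bn) := by have : 0 < A / ξ * bn := by positivity
                                   linarith
        _ = _ := by ring
    gcongr
  set mu := ∫ y in (0:ℝ)..1, g y ^ 2 with hmu
  have habs2 : ∀ y, g y ^ 2 ≤ |g y| := by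
    intro y
    have := hg.hb y
    rw [← sq_abs]
    nlinarith [abs_nonneg (g y)]
  have hmu1 : mu ≤ 8 * (1/2) ^ r := by
    refine le_trans ?_ hg.hl
    apply intervalIntegral.integral_mono_on (by norm_num)
    · exact (by fun_prop : Continuous fun y => g y ^ 2).intervalIntegrable _ _
    · exact (by fun_prop : Continuous fun y => |g y|).intervalIntegrable _ _
    · intro y _; exact habs2 y
  have hmu0 : 0 ≤ mu := intervalIntegral.integral_nonneg (by norm_num) fun y _ => sq_nonneg _
  have hmu2 : mu ≤ 1 := by
    have : mu ≤ ∫ y in (0:ℝ)..1, (1:ℝ) := by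
      apply intervalIntegral.integral_mono_on (by norm_num)
      · exact (by fun_prop : Continuous fun y => g y ^ 2).intervalIntegrable _ _
      · exact (by fun_prop : Continuous fun y => (1:ℝ)).intervalIntegrable _ _
      · intro y _; exact (habs2 y).trans (hg.hb y)
    simpa using this
  have k1 := key g hgc hg.per hg.hb hg.hm
  have k2 := key (fun y => g y ^ 2 - mu) (by fun_prop) (fun y => by simp only [hg.per y]) 
    (fun y => by 
      rw [abs_le]; constructor
      · linarith [sq_nonneg (g y)]
      · linarith [habs2 y, hg.hb y]) 
    (by
      rw [intervalIntegral.integral_sub]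
      · simp [hmu]
      · exact (by fun_prop : Continuous fun y => g y ^ 2).intervalIntegrable _ _
      · exact (by fun_prop : Continuous fun y => mu).intervalIntegrable _ _)
  have k3 : ∫ x in A..B, Real.exp (lam * (∑ m ∈ T, g (ξ * x ^ s m) + g (ξ * x ^ s n))) ≤
      ∫ x in A..B, ((1 + lam ^ 2 * mu) * G x + lam * (G x * g (ξ * x ^ s n)) 
        + lam ^ 2 * (G x * (g (ξ * x ^ s n) ^ 2 - mu))) := by
    apply intervalIntegral.integral_mono_on hAB'
    · exact Continuous.intervalIntegrable (by fun_prop) _ _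
    · exact Continuous.intervalIntegrable (by fun_prop) _ _
    · intro x _
      rw [mul_add, Real.exp_add]
      have : |lam * g (ξ * x ^ s n)| ≤ 1 := by
        rw [abs_mul, abs_of_nonneg hl0]
        have := hg.hb (ξ * x ^ s n)
        nlinarith [abs_nonneg (g (ξ * x ^ s n))]
      have := mul_le_mul_of_nonneg_left (exp_le_quad _ this) (hG0 x).le
      calc _ ≤ _ := this
        _ = _ := by ring
  rw [intervalIntegral.integral_add, intervalIntegral.integral_add, 
    intervalIntegral.integral_const_mul, intervalIntegral.integral_const_mul, 
    intervalIntegral.integral_const_mul] at k3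
  rotate_left
  · exact Continuous.intervalIntegrable (by fun_prop) _ _
  · exact Continuous.intervalIntegrable (by fun_prop) _ _
  · exact Continuous.intervalIntegrable (by fun_prop) _ _
  · exact Continuous.intervalIntegrable (by fun_prop) _ _
  refine k3.trans ?_
  set I1 := ∫ x in A..B, G x * g (ξ * x ^ s n)
  set I2 := ∫ x in A..B, G x * (g (ξ * x ^ s n) ^ 2 - mu)
  set W := 2 * A / ξ * bn with hW
  have hA0 : 0 < A := by linarith
  have hW0 : 0 ≤ W := by positivity
  have hη0 : 0 ≤ η := by positivity
  have d1 : lam * I1 ≤ lam * (W + (η + W) * E) := mul_le_mul_of_nonneg_left ((le_abs_self _).trans k1) hl0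
  have d2 : lam ^ 2 * I2 ≤ lam * (W + (η + W) * E) := by
    have q1 : lam ^ 2 * I2 ≤ lam ^ 2 * (W + (η + W) * E) := 
      mul_le_mul_of_nonneg_left ((le_abs_self _).trans k2) (sq_nonneg _)
    have q2 : lam ^ 2 ≤ lam := by nlinarith
    refine q1.trans ?_
    gcongr
  have d3 : lam * (W + (η + W) * E) ≤ W + (lam * η + W) * E := by
    have : lam * (W + (η + W) * E) = lam * W + (lam * η + lam * W) * E := by ring
    rw [this]
    have : lam * W ≤ W := by nlinarith
    gcongr
  have d4 : lam ^ 2 * mu * E ≤ lam ^ 2 * (8 * (1/2) ^ r) * E := by gcongr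
  have d5 : 4 * A / ξ * bn = 2 * W := by rw [hW]; ring
  rw [d5]
  have d6 : lam * η = 2 * CA * lam ^ 2 * (1/2) ^ r := by rw [hηdef]; ring
  rw [d6] at d3
  nlinarith [d1, d2, d3, d4]


lemma momT (ξ A B : ℝ) (hξ : 0 < ξ) (hA : 1 < A) (hAB : B - A = 1) (s : ℕ → ℕ) (hs : StrictMono s)
    (hs1 : ∀ n, 1 ≤ n → 1 ≤ s n) (r h : ℕ) (hh : (4:ℝ) ^ r ≤ A ^ h) (hh1 : 1 ≤ h)
    (g g' : ℝ → ℝ) (hg : Cls r g g') (lam : ℝ) (hl0 : 0 ≤ lam) (hl1 : lam ≤ 1)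
    (hlA : Real.exp lam ≤ Real.sqrt A) (T : Finset ℕ) : (∀ m ∈ T, 1 ≤ m) →
    (∀ m ∈ T, ∀ n ∈ T, m < n → m + h ≤ n) →
    (∫ x in A..B, Real.exp (lam * (∑ m ∈ T, g (ξ * x ^ s m)))) + 1 ≤
      2 * Real.exp ((4 * (A / (A - 1)) + 8) * lam ^ 2 * (1/2) ^ r * T.card
        + 4 * A / ξ * ∑ m ∈ T, (1 / Real.sqrt A) ^ m) := by
  induction T using Finset.induction_on_max with
  | empty => 
    intro _ _
    simp [hAB]; norm_num
  | insert n T hmax ih =>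
    intro h1 h2
    have hnT : n ∉ T := fun hn => lt_irrefl _ (hmax n hn)
    have ih' := ih (fun m hm => h1 m (Finset.mem_insert_of_mem hm))
      (fun m hm k hk => h2 m (Finset.mem_insert_of_mem hm) k (Finset.mem_insert_of_mem hk))
    have st := stepE ξ A B hξ hA hAB s hs hs1 r h hh hh1 g g' hg lam hl0 hl1 hlA T n
      (fun m hm => h1 m (Finset.mem_insert_of_mem hm))
      (fun m hm => h2 m (Finset.mem_insert_of_mem hm) n (Finset.mem_insert_self _ _) (hmax m hm))
      (h1 n (Finset.mem_insert_self _ _))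
    simp only [Finset.sum_insert hnT, Finset.card_insert_of_notMem hnT]
    simp only [add_comm (g (ξ * _ ^ s n))]
    set E := ∫ x in A..B, Real.exp (lam * (∑ m ∈ T, g (ξ * x ^ s m))) with hE
    have hE0 : 0 ≤ E := intervalIntegral.integral_nonneg (by linarith) fun x _ => (Real.exp_pos _).le
    set κ := (4 * (A / (A - 1)) + 8) * lam ^ 2 * (1/2) ^ r with hκ
    set W := 4 * A / ξ * (1 / Real.sqrt A) ^ n with hW
    have hκ0 : 0 ≤ κ := by
      have : 0 < A - 1 := by linarith
      positivity
    have hW0 : 0 ≤ W := by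
      have : 0 < A := by linarith
      positivity
    have e1 : (κ + W) + 1 ≤ Real.exp (κ + W) := Real.add_one_le_exp _
    calc _ ≤ (1 + κ + W) * E + W + 1 := by linarith
      _ ≤ (E + 1) * (κ + W + 1) := by nlinarith
      _ ≤ (2 * Real.exp (κ * T.card + 4 * A / ξ * ∑ m ∈ T, (1 / Real.sqrt A) ^ m)) * Real.exp (κ + W) := by
          gcongr
      _ = _ := by
          rw [mul_assoc, ← Real.exp_add]
          congr 2
          push_cast
          rw [hW]; ring

lemma geom_fin (b : ℝ) (hb0 : 0 ≤ b) (hb : b < 1) (T : Finset ℕ) : ∑ m ∈ T, b ^ m ≤ 1 / (1 - b) := by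
  rw [one_div, ← tsum_geometric_of_lt_one hb0 hb]
  exact (summable_geometric_of_lt_one hb0 hb).sum_le_tsum T (fun _ _ => by positivity)

/-- Exponential moment over arbitrary index sets. -/
lemma momI (ξ A B : ℝ) (hξ : 0 < ξ) (hA : 1 < A) (hAB : B - A = 1) : ∃ C : ℝ, 1 ≤ C ∧ ∃ H : ℕ, 1 ≤ H ∧
    ∃ l0 : ℝ, 0 < l0 ∧ 
    ∀ (s : ℕ → ℕ), StrictMono s → (∀ n, 1 ≤ n → 1 ≤ s n) → ∀ (r : ℕ)
    (g g' : ℝ → ℝ), Cls r g g' → ∀ lam : ℝ, 0 ≤ lam → lam ≤ l0 → 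
    ∀ I : Finset ℕ, (∀ m ∈ I, 1 ≤ m) →
    (∫ x in A..B, Real.exp (lam / (H * (r + 1)) * (∑ m ∈ I, g (ξ * x ^ s m)))) ≤
      C * Real.exp (C * lam ^ 2 * (1/2) ^ r * I.card) := by
  have hA0 : 0 < A := by linarith
  have hsA : 1 < Real.sqrt A := by rw [Real.lt_sqrt] <;> linarith
  obtain ⟨H, hH⟩ := pow_unbounded_of_one_lt (4:ℝ) hA
  set b := 1 / Real.sqrt A with hb
  have hb1 : b < 1 := by rw [hb, div_lt_one] <;> linarith
  have hb0 : 0 ≤ b := by positivity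
  have h1A : 0 < A - 1 := by linarith
  set C1 := 4 * (A / (A - 1)) + 8 with hC1
  have hC1p : 1 ≤ C1 := by
    have : 0 < A / (A - 1) := by positivity
    linarith
  set C2 := 2 * Real.exp (4 * A / ξ * (1 / (1 - b))) with hC2
  refine ⟨max C1 C2, le_trans hC1p (le_max_left _ _), H + 1, by omega, min 1 (Real.log (Real.sqrt A)), 
    lt_min one_pos (Real.log_pos hsA), ?_⟩
  intro s hs hs1 r g g' hg lam hl0 hl I hI
  have hl1 : lam ≤ 1 := hl.trans (min_le_left _ _)
  have hlA : Real.exp lam ≤ Real.sqrt A := by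
    rw [← Real.le_log_iff_exp_le (by linarith)]
    exact hl.trans (min_le_right _ _)
  set h := (H + 1) * (r + 1) with hh
  have hh1 : 1 ≤ h := Nat.mul_pos (by omega) (by omega)
  have hh4 : (4:ℝ) ^ r ≤ A ^ h := by
    calc (4:ℝ) ^ r ≤ (A ^ H) ^ r := by gcongr
      _ = A ^ (H * r) := by rw [pow_mul]
      _ ≤ A ^ h := pow_le_pow_right₀ hA.le (by rw [hh]; nlinarith)
  have hhR : (0:ℝ) < h := by exact_mod_cast hh1
  have hgc := hg.cont
  have e0 : (((H + 1 : ℕ):ℝ) * (r + 1)) = h := by rw [hh]; push_cast; ring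
  rw [e0]
  have jensen : ∀ x : ℝ, Real.exp (lam / h * (∑ m ∈ I, g (ξ * x ^ s m))) ≤ 
      ∑ q ∈ Finset.range h, (1 / h : ℝ) * Real.exp (lam * ∑ m ∈ I with m % h = q, g (ξ * x ^ s m)) := by
    intro x
    have e1 : ∑ m ∈ I, g (ξ * x ^ s m) = ∑ q ∈ Finset.range h, ∑ m ∈ I with m % h = q, g (ξ * x ^ s m) := by
      rw [Finset.sum_fiberwise_of_maps_to]
      intro m _
      exact Finset.mem_range.2 (Nat.mod_lt _ hh1)
    have := convexOn_exp.map_sum_le (t := Finset.range h) (w := fun _ => (1 / h : ℝ))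
      (p := fun q => lam * ∑ m ∈ I with m % h = q, g (ξ * x ^ s m)) (fun _ _ => by positivity)
      (by simp [hhR.ne']) (fun _ _ => Set.mem_univ _)
    simp only [smul_eq_mul] at this
    refine le_trans (le_of_eq ?_) this
    rw [e1, ← Finset.mul_sum, ← Finset.mul_sum]
    congr 1; ring
  have hAB' : A ≤ B := by linarith
  calc _ ≤ ∫ x in A..B, ∑ q ∈ Finset.range h, (1 / h : ℝ) * Real.exp (lam * ∑ m ∈ I with m % h = q, g (ξ * x ^ s m)) := by
        apply intervalIntegral.integral_mono_on hAB'
        · exact Continuous.intervalIntegrable (by fun_prop) _ _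
        · exact Continuous.intervalIntegrable (by fun_prop) _ _
        · intro x _; exact jensen x
    _ = ∑ q ∈ Finset.range h, (1 / h : ℝ) * ∫ x in A..B, Real.exp (lam * ∑ m ∈ I with m % h = q, g (ξ * x ^ s m)) := by
        rw [intervalIntegral.integral_finsetSum]
        · simp only [intervalIntegral.integral_const_mul]
        · intro q _
          exact Continuous.intervalIntegrable (by fun_prop) _ _
    _ ≤ ∑ q ∈ Finset.range h, (1 / h : ℝ) * (C2 * Real.exp (C1 * lam ^ 2 * (1/2) ^ r * I.card)) := by
        apply Finset.sum_le_sum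
        intro q _
        refine mul_le_mul_of_nonneg_left ?_ (by positivity)
        have := momT ξ A B hξ hA hAB s hs hs1 r h hh4 hh1 g g' hg lam hl0 hl1 hlA (I.filter (fun m => m % h = q))
          (fun m hm => hI m (Finset.mem_filter.1 hm).1)
          (fun m hm n hn hmn => by
            have a1 := (Finset.mem_filter.1 hm).2
            have a2 := (Finset.mem_filter.1 hn).2
            have a3 : m ≡ n [MOD h] := by rw [Nat.ModEq, a1, a2]
            have a4 := (Nat.modEq_iff_dvd' hmn.le).1 a3
            have := Nat.le_of_dvd (by omega) a4
            omega)
        refine le_trans (by linarith : _ ≤ _) (this.trans ?_)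
        rw [hC2, mul_assoc (2:ℝ), ← Real.exp_add]
        have c1 : ((I.filter (fun m => m % h = q)).card : ℝ) ≤ I.card := by
          exact_mod_cast Finset.card_filter_le _ _
        have c2 := geom_fin b hb0 hb1 (I.filter (fun m => m % h = q))
        rw [add_comm (4 * A / ξ * (1 / (1 - b)))]
        gcongr
    _ = C2 * Real.exp (C1 * lam ^ 2 * (1/2) ^ r * I.card) := by
        simp [hhR.ne']
    _ ≤ _ := by
        have : 0 < max C1 C2 := lt_of_lt_of_le (by linarith) (le_max_left _ _)
        gcongr
        · exact le_max_right _ _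
        · exact le_max_left _ _


noncomputable def sw (y : ℝ) : ℝ := Int.fract y - 1/2

lemma sw_add (y t : ℝ) (ht : 0 ≤ t) : sw (y + t) ≤ sw y + t := by
  unfold sw Int.fract
  have : (⌊y⌋:ℝ) ≤ ⌊y + t⌋ := by exact_mod_cast Int.floor_mono (by linarith)
  linarith

lemma sw_per : Function.Periodic sw 1 := by
  intro y; unfold sw; rw [Int.fract_add_one]

lemma sw_abs (y : ℝ) : |sw y| ≤ 1/2 := by
  unfold sw
  have := Int.fract_nonneg y
  have := (Int.fract_lt_one y).le
  rw [abs_le]; constructor <;> linarith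

lemma sw_int (a b : ℝ) : IntervalIntegrable sw volume a b := by
  apply IntervalIntegrable.mono_fun' (g := fun _ => (1/2:ℝ)) intervalIntegrable_const
  · exact (measurable_fract.sub_const _).aestronglyMeasurable
  · exact Filter.Eventually.of_forall fun y => sw_abs y

lemma sw_mean0 : ∫ y in (0:ℝ)..1, sw y = 0 := by
  have : ∫ y in (0:ℝ)..1, sw y = ∫ y in (0:ℝ)..1, (y - 1/2) := by
    apply intervalIntegral.integral_congr_ae
    have h1 : ∀ᵐ y : ℝ, y ≠ 1 := by
      simp [ae_iff, measure_singleton]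
    filter_upwards [h1] with y hy hy'
    rw [Set.uIoc_of_le (by norm_num)] at hy'
    unfold sw
    rw [Int.fract_eq_self.2 ⟨hy'.1.le, lt_of_le_of_ne hy'.2 hy⟩]
  rw [this, intervalIntegral.integral_sub (by simp) (by simp)]
  simp

lemma sw_mean (c : ℝ) : ∫ y in (0:ℝ)..1, sw (y + c) = 0 := by
  rw [intervalIntegral.integral_comp_add_right, zero_add, add_comm 1 c]
  have := sw_per.intervalIntegral_add_eq c 0
  rw [this, zero_add, sw_mean0]

lemma sw_int' (c a b : ℝ) : IntervalIntegrable (fun y => sw (y + c)) volume a b := by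
  simpa using (sw_int (a + c) (b + c)).comp_add_right c

noncomputable def avg (δ : ℝ) (f : ℝ → ℝ) (y : ℝ) : ℝ := δ⁻¹ * ∫ t in y..y+δ, f t

lemma avg_le {δ : ℝ} (hδ : 0 < δ) {f : ℝ → ℝ} {y c : ℝ} (hf : IntervalIntegrable f volume y (y+δ))
    (h : ∀ t ∈ Set.Icc y (y+δ), f t ≤ c) : avg δ f y ≤ c := by
  unfold avg
  have : ∫ t in y..y+δ, f t ≤ ∫ t in y..y+δ, c :=
    intervalIntegral.integral_mono_on (by linarith) hf (by simp) h
  simp at this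
  rw [inv_mul_le_iff₀ hδ]; exact this

lemma le_avg {δ : ℝ} (hδ : 0 < δ) {f : ℝ → ℝ} {y c : ℝ} (hf : IntervalIntegrable f volume y (y+δ))
    (h : ∀ t ∈ Set.Icc y (y+δ), c ≤ f t) : c ≤ avg δ f y := by
  unfold avg
  have : ∫ t in y..y+δ, c ≤ ∫ t in y..y+δ, f t :=
    intervalIntegral.integral_mono_on (by linarith) (by simp) hf h
  simp at this
  rw [le_inv_mul_iff₀ hδ]; exact this

lemma avg_per (δ : ℝ) {f : ℝ → ℝ} (hf : Function.Periodic f 1) : Function.Periodic (avg δ f) 1 := by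
  intro y
  unfold avg
  congr 1
  have := intervalIntegral.integral_comp_add_right (a := y) (b := y + δ) f 1
  simp only [hf _] at this
  rw [this]; congr 1; ring

lemma avg_cont (δ : ℝ) {f : ℝ → ℝ} (hf : ∀ a b, IntervalIntegrable f volume a b) :
    Continuous (avg δ f) := by
  have h1 := intervalIntegral.continuous_primitive hf 0
  have : avg δ f = fun y => δ⁻¹ * ((∫ t in (0:ℝ)..(y+δ), f t) - ∫ t in (0:ℝ)..y, f t) := by
    ext y
    unfold avg
    rw [intervalIntegral.integral_interval_sub_left (hf _ _) (hf _ _)]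
  rw [this]
  exact continuous_const.mul ((h1.comp (continuous_id.add continuous_const)).sub h1)

lemma avg_deriv (δ : ℝ) {f : ℝ → ℝ} (hf : Continuous f) (y : ℝ) :
    HasDerivAt (avg δ f) (δ⁻¹ * (f (y+δ) - f y)) y := by
  have h1 : ∀ t, HasDerivAt (fun u => ∫ t in (0:ℝ)..u, f t) (f t) t := fun t =>
    intervalIntegral.integral_hasDerivAt_right (hf.intervalIntegrable _ _)
      (hf.stronglyMeasurableAtFilter _ _) hf.continuousAt
  have : avg δ f = fun y => δ⁻¹ * ((∫ t in (0:ℝ)..(y+δ), f t) - ∫ t in (0:ℝ)..y, f t) := by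
    ext y
    unfold avg
    rw [intervalIntegral.integral_interval_sub_left (hf.intervalIntegrable _ _) (hf.intervalIntegrable _ _)]
  rw [this]
  exact (((h1 (y+δ)).comp_add_const y δ).sub (h1 y)).const_mul _

lemma exists_smooth (δ : ℝ) (hδ : 0 < δ) : ∃ φ φ' : ℝ → ℝ, (∀ y, HasDerivAt φ (φ' y) y) ∧
    Continuous φ' ∧ (∀ y, |φ' y| ≤ δ⁻¹) ∧ Function.Periodic φ 1 ∧ (∀ y, |φ y| ≤ 1) ∧
    ∫ y in (0:ℝ)..1, φ y = 0 ∧ (∀ y, φ y ≤ sw y + 4 * δ) ∧ (∀ y, sw (y + 2 * δ) - 4 * δ ≤ φ y) := by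
  set f1 := avg δ sw with hf1
  have c1 : Continuous f1 := avg_cont δ sw_int
  set f2 := avg δ f1 with hf2
  have c2 : Continuous f2 := avg_cont δ (fun a b => c1.intervalIntegrable a b)
  have p1 : Function.Periodic f1 1 := avg_per δ sw_per
  have p2 : Function.Periodic f2 1 := avg_per δ p1
  have b1 : ∀ y, |f1 y| ≤ 1/2 := fun y => abs_le.2 
    ⟨le_avg hδ (sw_int _ _) fun t _ => (abs_le.1 (sw_abs t)).1, 
     avg_le hδ (sw_int _ _) fun t _ => (abs_le.1 (sw_abs t)).2⟩
  have b2 : ∀ y, |f2 y| ≤ 1/2 := fun y => abs_le.2 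
    ⟨le_avg hδ (c1.intervalIntegrable _ _) fun t _ => (abs_le.1 (b1 t)).1, 
     avg_le hδ (c1.intervalIntegrable _ _) fun t _ => (abs_le.1 (b1 t)).2⟩
  have u1 : ∀ y, f1 y ≤ sw y + δ := fun y => avg_le hδ (sw_int _ _) fun t ht => by
    have := sw_add y (t - y) (by linarith [ht.1])
    rw [add_sub_cancel] at this
    linarith [ht.2]
  have u2 : ∀ y, f2 y ≤ sw y + 2 * δ := fun y => avg_le hδ (c1.intervalIntegrable _ _) fun t ht => by
    have := sw_add y (t - y) (by linarith [ht.1])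
    rw [add_sub_cancel] at this
    linarith [ht.2, u1 t]
  have l1 : ∀ y, sw (y + δ) - δ ≤ f1 y := fun y => le_avg hδ (sw_int _ _) fun t ht => by
    have := sw_add t (y + δ - t) (by linarith [ht.2])
    rw [add_sub_cancel] at this
    linarith [ht.1]
  have l2 : ∀ y, sw (y + 2 * δ) - 2 * δ ≤ f2 y := fun y => le_avg hδ (c1.intervalIntegrable _ _) fun t ht => by
    have := sw_add (t + δ) (y + δ - t) (by linarith [ht.2])
    rw [show t + δ + (y + δ - t) = y + 2 * δ by ring] at this
    linarith [ht.1, l1 t]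
  set μ := ∫ y in (0:ℝ)..1, f2 y with hμ
  have m1 : μ ≤ 2 * δ := by
    have : μ ≤ ∫ y in (0:ℝ)..1, (sw y + 2 * δ) := 
      intervalIntegral.integral_mono_on (by norm_num) (c2.intervalIntegrable _ _) 
        ((sw_int _ _).add (by simp)) fun y _ => u2 y
    rw [intervalIntegral.integral_add (sw_int _ _) (by simp), sw_mean0] at this
    simpa using this
  have m2 : - (2 * δ) ≤ μ := by
    have : ∫ y in (0:ℝ)..1, (sw (y + 2 * δ) - 2 * δ) ≤ μ := 
      intervalIntegral.integral_mono_on (by norm_num) ((sw_int' _ _ _).sub (by simp)) (c2.intervalIntegrable _ _) 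
        fun y _ => l2 y
    rw [intervalIntegral.integral_sub (sw_int' _ _ _) (by simp), sw_mean] at this
    simpa using this
  have m3 : |μ| ≤ 1/2 := by
    have := intervalIntegral.norm_integral_le_of_norm_le_const (a := (0:ℝ)) (b := 1) (C := 1/2) (f := f2)
      (fun x _ => b2 x)
    simpa using this
  refine ⟨fun y => f2 y - μ, fun y => δ⁻¹ * (f1 (y+δ) - f1 y), fun y => (avg_deriv δ c1 y).sub_const μ, 
    by fun_prop, ?_, ?_, ?_, ?_, ?_, ?_⟩
  · intro y
    rw [abs_mul, abs_of_pos (inv_pos.2 hδ)]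
    have : |f1 (y+δ) - f1 y| ≤ 1 := (abs_sub _ _).trans (by linarith [b1 (y+δ), b1 y])
    have h0 := inv_pos.2 hδ
    nlinarith
  · intro y; simp only [p2 y]
  · intro y; exact (abs_sub _ _).trans (by linarith [b2 y])
  · rw [intervalIntegral.integral_sub (c2.intervalIntegrable _ _) (by simp)]
    simp [hμ]
  · intro y; linarith [u2 y]
  · intro y; linarith [l2 y]

noncomputable def ph (r : ℕ) : ℝ → ℝ := (exists_smooth ((1/2:ℝ)^r) (by positivity)).choose

noncomputable def gf (r k i : ℕ) (y : ℝ) : ℝ :=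
  (ph (r+1) (y - (2 * k + i : ℕ) * (1/2:ℝ)^(r+1)) - ph r (y - k * (1/2:ℝ)^r)) / 2

lemma gf_cls (r k i : ℕ) (hi : i < 8) : ∃ g', Cls r (gf r k i) g' := by
  obtain ⟨φ', d0, c0, b0, p0, a0, m0, u0, l0⟩ := (exists_smooth ((1/2:ℝ)^r) (by positivity)).choose_spec
  obtain ⟨ψ', d1, c1, b1, p1, a1, m1, u1, l1⟩ := (exists_smooth ((1/2:ℝ)^(r+1)) (by positivity)).choose_spec
  change ∀ y, HasDerivAt (ph r) _ y at d0
  change ∀ y, HasDerivAt (ph (r+1)) _ y at d1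
  change Function.Periodic (ph r) 1 at p0
  change Function.Periodic (ph (r+1)) 1 at p1
  change ∀ y, |ph r y| ≤ 1 at a0
  change ∀ y, |ph (r+1) y| ≤ 1 at a1
  change ∫ y in (0:ℝ)..1, ph r y = 0 at m0
  change ∫ y in (0:ℝ)..1, ph (r+1) y = 0 at m1
  change ∀ y, ph r y ≤ _ at u0
  change ∀ y, ph (r+1) y ≤ _ at u1
  change ∀ y, _ ≤ ph r y at l0
  change ∀ y, _ ≤ ph (r+1) y at l1
  have k0 : Continuous (ph r) := continuous_iff_continuousAt.2 fun x => (d0 x).continuousAt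
  have k1 : Continuous (ph (r+1)) := continuous_iff_continuousAt.2 fun x => (d1 x).continuousAt
  set δ : ℝ := (1/2)^r with hδ
  have hδ0 : 0 < δ := by positivity
  have hδ1 : (1/2:ℝ)^(r+1) = δ / 2 := by rw [pow_succ]; ring
  rw [hδ1] at b1 u1 l1
  set u : ℝ := k * δ with hu
  set v : ℝ := (2 * k + i : ℕ) * (δ/2) with hv
  have hvu : v = u + i * (δ/2) := by rw [hv, hu]; push_cast; ring
  have hgf : gf r k i = fun y => (ph (r+1) (y - v) - ph r (y - u)) / 2 := by
    ext y; unfold gf; rw [hδ1]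
  have hi' : (i:ℝ) ≤ 8 := by exact_mod_cast hi.le
  have hi0 : (0:ℝ) ≤ i := by positivity
  rw [hgf]
  have per_mean : ∀ (f : ℝ → ℝ) (c : ℝ), Function.Periodic f 1 → ∫ y in (0:ℝ)..1, f y = 0 → 
      ∫ y in (0:ℝ)..1, f (y - c) = 0 := by
    intro f c hf h0
    rw [intervalIntegral.integral_comp_sub_right, zero_sub, show 1 - c = -c + 1 by ring, 
      hf.intervalIntegral_add_eq (-c) 0, zero_add, h0]
  refine ⟨fun y => (ψ' (y - v) - φ' (y - u)) / 2, ?_, by fun_prop, ?_, ?_, ?_, ?_, ?_⟩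
  · intro y
    exact (((d1 (y - v)).comp_sub_const y v).sub ((d0 (y-u)).comp_sub_const y u)).div_const 2
  · intro y
    have e1 := b1 (y - v)
    have e2 := b0 (y - u)
    have e3 : δ⁻¹ = 2 ^ r := by rw [hδ]; simp
    have e4 : (δ/2)⁻¹ = 2 * 2 ^ r := by rw [inv_div, div_eq_mul_inv, e3]
    rw [e3] at e2
    rw [e4] at e1
    have : (0:ℝ) < 2 ^ r := by positivity
    rw [abs_div, abs_two]
    have := abs_sub (ψ' (y - v)) (φ' (y - u))
    linarith
  · intro y
    have e1 := p1 (y - v)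
    have e2 := p0 (y - u)
    simp only
    rw [show y + 1 - v = y - v + 1 by ring, show y + 1 - u = y - u + 1 by ring, e1, e2]
  · intro y
    rw [abs_div, abs_two]
    have := abs_sub (ph (r+1) (y - v)) (ph r (y - u))
    linarith [a1 (y-v), a0 (y-u)]
  · rw [intervalIntegral.integral_div, intervalIntegral.integral_sub, per_mean _ _ p1 m1, per_mean _ _ p0 m0]
    · simp
    · exact Continuous.intervalIntegrable (by fun_prop) _ _
    · exact Continuous.intervalIntegrable (by fun_prop) _ _
  · have key : ∀ y, |(ph (r+1) (y - v) - ph r (y - u)) / 2| ≤ 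
        (sw (y + (-u - 4 * δ)) - sw (y + (-u + 2 * δ)) + 16 * δ) / 2 := by
      intro y
      rw [abs_div, abs_two]
      have h1 := u0 (y - u)
      have h2 := l0 (y - u)
      have h3 := u1 (y - v)
      have h4 := l1 (y - v)
      have h5 := sw_add (y + (-u - 4 * δ)) (4 * δ) (by linarith)
      have h6 := sw_add (y + (-u - 4 * δ)) (u + 4 * δ - v) (by rw [hvu]; nlinarith)
      have h7 := sw_add (y - v + 2 * (δ/2)) (v - u + δ) (by rw [hvu]; nlinarith)
      rw [show y + (-u - 4 * δ) + 4 * δ = y - u by ring] at h5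
      rw [show y + (-u - 4 * δ) + (u + 4 * δ - v) = y - v by ring] at h6
      rw [show y - v + 2 * (δ/2) + (v - u + δ) = y - u + 2 * δ by ring] at h7
      rw [show y + (-u + 2 * δ) = y - u + 2 * δ by ring]
      have h8 : i * (δ/2) ≤ 4 * δ := by nlinarith
      have h9 : 0 ≤ i * (δ/2) := by positivity
      have : |ph (r+1) (y - v) - ph r (y - u)| ≤ 
        (sw (y + (-u - 4 * δ)) - sw (y - u + 2 * δ) + 16 * δ) := by
        rw [abs_le]; constructor <;> linarith
      linarith
    calc _ ≤ ∫ y in (0:ℝ)..1, (sw (y + (-u - 4 * δ)) - sw (y + (-u + 2 * δ)) + 16 * δ) / 2 := by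
          apply intervalIntegral.integral_mono_on (by norm_num)
          · exact Continuous.intervalIntegrable (by fun_prop) _ _
          · exact (((sw_int' _ _ _).sub (sw_int' _ _ _)).add (by simp)).div_const 2
          · intro y _; exact key y
      _ = 8 * δ := by
          rw [intervalIntegral.integral_div, intervalIntegral.integral_add ((sw_int' _ _ _).sub (sw_int' _ _ _)) (by simp), 
            intervalIntegral.integral_sub (sw_int' _ _ _) (sw_int' _ _ _), sw_mean, sw_mean]
          simp; ring
      _ ≤ _ := le_rfl

lemma chainN (m : ℕ) (f : ℕ → ℝ) (τ : ℕ → ℝ) (hτ : ∀ j, 0 ≤ τ j)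
    (h : ∀ j ≤ m, ∀ l < 2 ^ j, |∑ n ∈ Finset.Ioc (l * 2 ^ (m - j)) ((l + 1) * 2 ^ (m - j)), f n| ≤ τ j)
    (N : ℕ) (hN : N < 2 ^ m) : |∑ n ∈ Finset.Ioc 0 N, f n| ≤ ∑ j ∈ Finset.range (m + 1), τ j := by
  have key : ∀ j ≤ m, |∑ n ∈ Finset.Ioc 0 (N / 2 ^ (m - j) * 2 ^ (m - j)), f n| ≤
      ∑ i ∈ Finset.range (j + 1), τ i := by
    intro j
    induction j with
    | zero =>
      intro _
      rw [Nat.sub_zero, Nat.div_eq_of_lt hN]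
      simp [hτ 0]
    | succ j ih =>
      intro hj
      have ih' := ih (by omega)
      rw [Finset.sum_range_succ]
      obtain ⟨d, hd⟩ : ∃ d, d = 2 ^ (m - (j + 1)) := ⟨_, rfl⟩
      have hd0 : 0 < d := by rw [hd]; positivity
      have e1 : 2 ^ (m - j) = d * 2 := by
        rw [hd, ← pow_succ]; congr 1; omega
      rw [e1, ← Nat.div_div_eq_div_mul] at ih'
      have hq : N / d < 2 ^ (j + 1) := by
        rw [Nat.div_lt_iff_lt_mul hd0, hd, ← pow_add]
        rw [show j + 1 + (m - (j+1)) = m by omega]; exact hN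
      rw [← hd]
      set q := N / d with hqd
      rcases Nat.even_or_odd' q with ⟨c, hc | hc⟩
      · have : q / 2 * (d * 2) = q * d := by
          rw [hc, Nat.mul_div_cancel_left _ (by norm_num)]; ring
        rw [this] at ih'
        linarith [hτ (j+1)]
      · have h2 : q / 2 = c := by omega
        rw [h2] at ih'
        have h3 := h (j+1) hj (q - 1) (by omega)
        rw [← hd] at h3
        have h4 : (q - 1) * d = c * (d * 2) := by
          rw [hc]; simp; ring
        have h5 : q - 1 + 1 = q := by omega
        rw [h5, h4] at h3
        have h6 : c * (d * 2) ≤ q * d := by rw [hc]; nlinarith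
        rw [← Finset.sum_Ioc_consecutive _ (Nat.zero_le _) h6]
        exact (abs_add_le _ _).trans (add_le_add ih' h3)
  have := key m le_rfl
  simpa using this

lemma chainR (p R : ℕ) (F : ℕ → ℕ → ℝ) (τ : ℕ → ℝ)
    (h : ∀ r, R ≤ r → r < p → ∀ k < 2 ^ (r + 3), ∀ i < 8, |F (r+1) (2 * k + i) - F r k| ≤ τ r)
    (d : ℕ) : R + d ≤ p → ∀ k < 2 ^ (R + d + 3), 
      |F (R + d) k - F R (k / 2 ^ d)| ≤ ∑ r ∈ Finset.Ico R (R + d), τ r := by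
  induction d with
  | zero => intro _ k _; simp
  | succ d ih =>
    intro hd k hk
    have hk2 : k / 2 < 2 ^ (R + d + 3) := by
      rw [Nat.div_lt_iff_lt_mul (by norm_num), ← pow_succ]
      convert hk using 2
      omega
    have e1 := ih (by omega) (k / 2) hk2
    have e2 := h (R + d) (by omega) (by omega) (k / 2) hk2 (k % 2) (by omega)
    rw [show 2 * (k / 2) + k % 2 = k by omega] at e2
    rw [Nat.div_div_eq_div_mul, ← pow_succ'] at e1
    rw [← add_assoc, Finset.sum_Ico_succ_top (by omega)]
    calc _ = |(F (R + d + 1) k - F (R + d) (k / 2)) + (F (R+d) (k/2) - F R (k / 2 ^ (d+1)))| := by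
          congr 1; ring
      _ ≤ _ := (abs_add_le _ _).trans (by linarith)

lemma chainR2 (p R : ℕ) (hRp : R < p) (F : ℕ → ℕ → ℝ) (τ : ℕ → ℝ) (hτ : ∀ j, 0 ≤ τ j)
    (h : ∀ r, R ≤ r → r < p → ∀ k < 2 ^ (r + 3), ∀ i < 8, |F (r+1) (2 * k + i) - F r k| ≤ τ r)
    (a : ℕ) (ha : a < 2 ^ R) (k1 k2 : ℕ) (h1 : a * 2 ^ (p - R) ≤ k1) (h1' : k1 ≤ (a + 1) * 2 ^ (p - R) + 2)
    (h2 : a * 2 ^ (p - R) ≤ k2) (h2' : k2 ≤ (a + 1) * 2 ^ (p - R) + 2) :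
    |F p k1 - F p k2| ≤ 6 * ∑ r ∈ Finset.Ico R p, τ r := by
  have hone : ∀ k, a * 2 ^ (p - R) ≤ k → k ≤ (a + 1) * 2 ^ (p - R) + 2 → 
      |F p k - F R a| ≤ 3 * ∑ r ∈ Finset.Ico R p, τ r := by
    intro k hk hk'
    obtain ⟨d, rfl⟩ : ∃ d, p = R + d := ⟨p - R, by omega⟩
    rw [Nat.add_sub_cancel_left] at hk hk'
    have hd : 1 ≤ 2 ^ d := Nat.one_le_two_pow
    have hk3 : k < 2 ^ (R + d + 3) := by
      rw [pow_add, pow_add]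
      have : (a + 1) * 2 ^ d ≤ 2 ^ R * 2 ^ d := Nat.mul_le_mul_right _ ha
      have : 1 ≤ 2 ^ R * 2 ^ d := Nat.mul_pos (by positivity) (by positivity)
      omega
    have c1 := chainR (R + d) R F τ h d le_rfl k hk3
    obtain ⟨i, hi⟩ : ∃ i, k / 2 ^ d = a + i := ⟨k / 2 ^ d - a, by
      have : a ≤ k / 2 ^ d := by rw [Nat.le_div_iff_mul_le (by positivity)]; exact hk
      omega⟩
    have hi4 : i < 4 := by
      have : k / 2 ^ d < a + 4 := by
        rw [Nat.div_lt_iff_lt_mul (by positivity)]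
        nlinarith
      omega
    rw [hi] at c1
    have hR3 : 2 ^ (R + 3) = 2 ^ R * 8 := by rw [pow_add]; norm_num
    have hR1 : 1 ≤ 2 ^ R := Nat.one_le_two_pow
    have c2 := h R le_rfl hRp (a + i) (by omega) 0 (by norm_num)
    have c3 := h R le_rfl hRp a (by omega) (2 * i) (by omega)
    rw [show 2 * (a + i) + 0 = 2 * a + 2 * i by ring] at c2
    have c4 : τ R ≤ ∑ r ∈ Finset.Ico R (R + d), τ r := 
      Finset.single_le_sum (f := τ) (fun r _ => hτ r) (by simp; omega)
    rw [abs_le] at *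
    constructor <;> linarith [c1.1, c1.2, c2.1, c2.2, c3.1, c3.2]
  have e1 := hone k1 h1 h1'
  have e2 := hone k2 h2 h2'
  rw [abs_le] at *
  constructor <;> linarith [e1.1, e1.2, e2.1, e2.2]

lemma ind_sw (y α b : ℝ) (hα : 0 ≤ α) (hb : 0 ≤ b) (hab : α + b ≤ 1) :
    Set.indicator (Set.Ico α (α + b)) (fun _ => (1:ℝ)) (Int.fract y) - b = sw (y - (α + b)) - sw (y - α) := by
  have f0 := Int.fract_nonneg y
  have f1 := Int.fract_lt_one y
  have f2 := Int.self_sub_floor y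
  have gen : ∀ c, 0 ≤ c → c ≤ 1 → Int.fract (y - c) = if c ≤ Int.fract y then Int.fract y - c else Int.fract y - c + 1 := by
    intro c hc hc1
    split_ifs with h
    · rw [Int.fract_eq_iff]
      exact ⟨by linarith, by linarith, ⌊y⌋, by linarith⟩
    · push Not at h
      rw [Int.fract_eq_iff]
      exact ⟨by linarith, by linarith, ⌊y⌋ - 1, by push_cast; linarith⟩
  unfold sw
  rw [gen α hα (by linarith), gen (α + b) (by linarith) hab, Set.indicator_apply]
  simp only [Set.mem_Ico]
  by_cases h1 : α ≤ Int.fract y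
  · by_cases h2 : α + b ≤ Int.fract y
    · rw [if_neg (by intro h; linarith [h.2]), if_pos h2, if_pos h1]; ring
    · rw [if_pos ⟨h1, by linarith⟩, if_neg h2, if_pos h1]; ring
  · rw [if_neg (by intro h; exact h1 h.1), if_neg (by linarith), if_neg h1]; ring

lemma ph_up (r : ℕ) (y : ℝ) : ph r y ≤ sw y + 4 * (1/2)^r := 
  (exists_smooth ((1/2:ℝ)^r) (by positivity)).choose_spec.choose_spec.2.2.2.2.2.2.1 y
lemma ph_low (r : ℕ) (y : ℝ) : sw (y + 2 * (1/2)^r) - 4 * (1/2)^r ≤ ph r y := 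
  (exists_smooth ((1/2:ℝ)^r) (by positivity)).choose_spec.choose_spec.2.2.2.2.2.2.2 y

lemma detBound (p R N : ℕ) (hRp : R < p) (y : ℕ → ℝ) (τ : ℕ → ℝ) (hτ : ∀ j, 0 ≤ τ j)
    (h : ∀ r, R ≤ r → r < p → ∀ k < 2 ^ (r + 3), ∀ i < 8, |∑ n ∈ Finset.Ioc 0 N, gf r k i (y n)| ≤ τ r) :
    smallDisc R N (fun n => Int.fract (y n)) ≤ (12 * ∑ r ∈ Finset.Ico R p, τ r + 10 * (1/2)^p * N) / N := by
  have hI : Finset.Icc 1 N = Finset.Ioc 0 N := by ext; simp [Nat.succ_le_iff]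
  set δ : ℝ := (1/2)^p with hδ
  have hδ0 : 0 < δ := by positivity
  have hS0 : 0 ≤ ∑ r ∈ Finset.Ico R p, τ r := Finset.sum_nonneg fun r _ => hτ r
  set F : ℕ → ℕ → ℝ := fun r k => ∑ n ∈ Finset.Ioc 0 N, ph r (y n - k * (1/2)^r) with hF
  have hFd : ∀ r, R ≤ r → r < p → ∀ k < 2 ^ (r + 3), ∀ i < 8, |F (r+1) (2 * k + i) - F r k| ≤ 2 * τ r := by
    intro r h1 h2 k hk i hi
    have := h r h1 h2 k hk i hi
    have e : F (r+1) (2 * k + i) - F r k = 2 * ∑ n ∈ Finset.Ioc 0 N, gf r k i (y n) := by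
      simp only [hF, gf]
      rw [← Finset.sum_sub_distrib, Finset.mul_sum]
      apply Finset.sum_congr rfl
      intro n _; ring
    rw [e, abs_mul, abs_two]
    linarith
  set D : ℝ → ℝ := fun v => ∑ n ∈ Finset.Ioc 0 N, sw (y n - v) with hD
  have hcard : ∀ c : ℝ, ∑ n ∈ Finset.Ioc 0 N, c = N * c := by intro c; simp
  have Dup : ∀ (v : ℝ) (k : ℕ), v ≤ k * δ → k * δ ≤ v + δ → D v ≤ F p (k + 2) + 5 * δ * N := by
    intro v k h1 h2
    have : D v ≤ ∑ n ∈ Finset.Ioc 0 N, (ph p (y n - ((k + 2 : ℕ):ℝ) * (1/2)^p) + 5 * δ) := by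
      apply Finset.sum_le_sum
      intro n _
      have e1 := sw_add (y n - k * δ) (k * δ - v) (by linarith)
      rw [show y n - k * δ + (k * δ - v) = y n - v by ring] at e1
      have e2 := ph_low p (y n - ((k + 2 : ℕ):ℝ) * (1/2)^p)
      rw [← hδ] at e2 ⊢
      rw [show y n - ((k + 2 : ℕ):ℝ) * δ + 2 * δ = y n - k * δ by push_cast; ring] at e2
      linarith
    rw [Finset.sum_add_distrib, hcard] at this
    simp only [hF]; linarith
  have Dlow : ∀ (v : ℝ) (k : ℕ), k * δ ≤ v → v ≤ k * δ + δ → F p k - 5 * δ * N ≤ D v := by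
    intro v k h1 h2
    have : ∑ n ∈ Finset.Ioc 0 N, (ph p (y n - (k:ℝ) * (1/2)^p) - 5 * δ) ≤ D v := by
      apply Finset.sum_le_sum
      intro n _
      have e1 := sw_add (y n - v) (v - k * δ) (by linarith)
      rw [show y n - v + (v - k * δ) = y n - k * δ by ring] at e1
      have e2 := ph_up p (y n - (k:ℝ) * (1/2)^p)
      rw [← hδ] at e2 ⊢
      linarith
    rw [Finset.sum_sub_distrib, hcard] at this
    simp only [hF]; linarith
  apply Real.sSup_le
  · rintro _ ⟨a, ha, b, hb0, hb1, rfl⟩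
    rw [abs_div, Nat.abs_cast]
    refine div_le_div_of_nonneg_right ?_ (by positivity)
    set ε : ℝ := (2:ℝ) ^ (-(R:ℤ)) with hε
    have hε0 : 0 < ε := by positivity
    have hεp : ε = 2 ^ (p - R) * δ := by
      rw [hε, hδ, zpow_neg, zpow_natCast, one_div, inv_pow]
      have : (2:ℝ) ^ p = 2 ^ (p - R) * 2 ^ R := by rw [← pow_add]; congr 1; omega
      rw [this]; field_simp
    have hε1 : 2 ^ R * ε = 1 := by
      rw [hε, zpow_neg, zpow_natCast, mul_inv_cancel₀ (by positivity)]
    have ha' : (a:ℝ) + 1 ≤ 2 ^ R := by exact_mod_cast ha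
    have hab : a * ε + b ≤ 1 := by nlinarith
    have hsum : ∑ n ∈ Finset.Icc 1 N, (Set.indicator (Set.Ico (a * ε) (a * ε + b)) (fun _ => (1:ℝ)) (Int.fract (y n)) - b)
        = D (a * ε + b) - D (a * ε) := by
      rw [hI, hD, ← Finset.sum_sub_distrib]
      apply Finset.sum_congr rfl
      intro n _
      exact ind_sw (y n) (a * ε) b (by positivity) hb0 hab
    rw [hsum]
    have bd : ∀ v, a * ε ≤ v → v ≤ a * ε + ε → ∃ k1 k2 : ℕ, 
        (a * 2 ^ (p - R) ≤ k1 ∧ k1 ≤ (a + 1) * 2 ^ (p - R) + 2) ∧ 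
        (a * 2 ^ (p - R) ≤ k2 ∧ k2 ≤ (a + 1) * 2 ^ (p - R) + 2) ∧ 
        D v ≤ F p k1 + 5 * δ * N ∧ F p k2 - 5 * δ * N ≤ D v := by
      intro v hv1 hv2
      have hv0 : 0 ≤ v := le_trans (by positivity) hv1
      have w1 : ((a * 2 ^ (p - R) : ℕ):ℝ) ≤ v / δ := by
        rw [le_div_iff₀ hδ0]; push_cast; rw [hεp] at hv1; linarith
      have w2 : v / δ ≤ (((a + 1) * 2 ^ (p - R) : ℕ):ℝ) := by
        rw [div_le_iff₀ hδ0]; push_cast; rw [hεp] at hv2; linarith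
      refine ⟨⌈v / δ⌉₊ + 2, ⌊v / δ⌋₊, ⟨?_, ?_⟩, ⟨?_, ?_⟩, Dup _ _ ?_ ?_, Dlow _ _ ?_ ?_⟩
      · have := Nat.le_ceil (v / δ)
        have : ((a * 2 ^ (p - R) : ℕ):ℝ) ≤ (⌈v/δ⌉₊ : ℝ) := w1.trans this
        have := Nat.cast_le.1 this
        omega
      · have := Nat.ceil_le.2 w2
        omega
      · exact Nat.le_floor w1
      · have : (⌊v/δ⌋₊:ℝ) ≤ (((a + 1) * 2 ^ (p - R) : ℕ):ℝ) := (Nat.floor_le (by positivity)).trans w2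
        have := Nat.cast_le.1 this
        omega
      · rw [← div_le_iff₀ hδ0]; exact Nat.le_ceil _
      · have := Nat.ceil_lt_add_one (a := v / δ) (by positivity)
        have h2 : (⌈v/δ⌉₊:ℝ) * δ ≤ (v / δ + 1) * δ := by gcongr
        rw [add_mul, div_mul_cancel₀ _ hδ0.ne'] at h2
        linarith
      · rw [← le_div_iff₀ hδ0]; exact Nat.floor_le (by positivity)
      · have := Nat.lt_floor_add_one (v / δ)
        have h2 : (v / δ) * δ ≤ (⌊v/δ⌋₊ + 1) * δ := by gcongr
        rw [add_mul, div_mul_cancel₀ _ hδ0.ne'] at h2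
        linarith
    obtain ⟨k1, k2, hk1, hk2, hk3, hk4⟩ := bd (a * ε + b) (by linarith) (by linarith)
    obtain ⟨l1, l2, hl1, hl2, hl3, hl4⟩ := bd (a * ε) le_rfl (by linarith)
    have hτ2 : ∀ j, 0 ≤ 2 * τ j := fun j => by linarith [hτ j]
    have q1 := chainR2 p R hRp F (fun r => 2 * τ r) hτ2 hFd a ha k1 l2 hk1.1 hk1.2 hl2.1 hl2.2
    have q2 := chainR2 p R hRp F (fun r => 2 * τ r) hτ2 hFd a ha k2 l1 hk2.1 hk2.2 hl1.1 hl1.2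
    rw [← Finset.mul_sum] at q1 q2
    rw [abs_le] at q1 q2 ⊢
    constructor <;> linarith [q1.1, q1.2, q2.1, q2.2]
  · positivity


lemma bc (A B : ℝ) (hAB : A ≤ B) (f : ℕ → ℝ → ℝ) (hf : ∀ p, Continuous (f p)) (hf0 : ∀ p x, 0 ≤ f p x)
    (a : ℕ → ℝ) (ha : Summable a) (p0 : ℕ) (hfa : ∀ p, p0 ≤ p → ∫ x in A..B, f p x ≤ a p) :
    ∀ᵐ x : ℝ ∂volume, x ∈ Set.Icc A B → ∀ᶠ p in atTop, f p x ≤ 1 := by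
  rw [← ae_restrict_iff' measurableSet_Icc]
  set μ := volume.restrict (Set.Icc A B) with hμ
  have h1 : ∀ p, ∫⁻ x, ENNReal.ofReal (f (p + p0) x) ∂μ ≤ ENNReal.ofReal (a (p + p0)) := by
    intro p
    rw [← ofReal_integral_eq_lintegral_ofReal]
    · apply ENNReal.ofReal_le_ofReal
      rw [hμ, integral_Icc_eq_integral_Ioc, ← intervalIntegral.integral_of_le hAB]
      exact hfa _ (by omega)
    · exact (hf _).integrableOn_Icc
    · exact Filter.Eventually.of_forall fun x => hf0 _ x
  have ha' : Summable fun p => a (p + p0) := (summable_nat_add_iff p0).2 ha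
  have h2 : ∫⁻ x, ∑' p, ENNReal.ofReal (f (p + p0) x) ∂μ ≠ ⊤ := by
    rw [lintegral_tsum (fun p => ((hf _).measurable.ennreal_ofReal).aemeasurable)]
    exact ne_top_of_le_ne_top ha'.tsum_ofReal_ne_top (ENNReal.tsum_le_tsum h1)
  have h3 := ae_lt_top' (AEMeasurable.ennreal_tsum (fun p => ((hf (p + p0)).measurable.ennreal_ofReal).aemeasurable)) h2
  filter_upwards [h3] with x hx
  have h4 := ENNReal.tendsto_atTop_zero_of_tsum_ne_top hx.ne
  have h5 : ∀ᶠ p in atTop, ENNReal.ofReal (f (p + p0) x) < 1 := h4.eventually_lt_const (by norm_num)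
  obtain ⟨q, hq⟩ := eventually_atTop.1 h5
  refine eventually_atTop.2 ⟨q + p0, fun p hp => ?_⟩
  have := hq (p - p0) (by omega)
  rw [Nat.sub_add_cancel (by omega)] at this
  exact (ENNReal.ofReal_lt_one.1 this).le

noncomputable def rho : ℝ := (2:ℝ) ^ (1/8:ℝ)

lemma rho8 : rho ^ 8 = 2 := by
  unfold rho
  rw [← Real.rpow_natCast, ← Real.rpow_mul (by norm_num)]; norm_num

lemma rho1 : 1 < rho := by
  unfold rho
  exact Real.one_lt_rpow (by norm_num) (by norm_num)

lemma rho_poly : ∃ K0 : ℝ, 1 ≤ K0 ∧ ∀ m : ℕ, ((m:ℝ) + 1) ^ 2 ≤ K0 * rho ^ m := by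
  have h := (tendsto_pow_const_div_const_pow_of_one_lt 2 rho1).bddAbove_range
  obtain ⟨K, hK⟩ := h
  have h0 : 0 < rho := by linarith [rho1]
  refine ⟨max 1 (K * rho), le_max_left _ _, fun m => ?_⟩
  have := hK ⟨m + 1, rfl⟩
  simp only at this
  rw [div_le_iff₀ (by positivity), pow_succ rho m] at this
  push_cast at this
  calc ((m:ℝ)+1)^2 ≤ (K * rho) * rho ^ m := by linarith
    _ ≤ _ := by gcongr; exact le_max_right _ _

noncomputable def lamf (p j r : ℕ) : ℝ := rho ^ (2 * (j + r)) * Real.sqrt (Real.log p) / 2 ^ p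

noncomputable def thr (K : ℝ) (p m : ℕ) : ℝ := K * 2 ^ p * Real.sqrt (Real.log p) / rho ^ m

lemma lam_small (l0 : ℝ) (hl0 : 0 < l0) : ∃ p0 : ℕ, ∀ p, p0 ≤ p → ∀ r < p, ∀ j < 2 * p + 1, lamf p j r ≤ l0 := by
  have h := tendsto_pow_const_div_const_pow_of_one_lt 1 rho1
  have h2 : ∀ᶠ p : ℕ in atTop, (p:ℝ) ^ 1 / rho ^ p < l0 := h.eventually_lt_const hl0
  obtain ⟨q, hq⟩ := eventually_atTop.1 h2
  refine ⟨q + 1, fun p hp r hr j hj => ?_⟩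
  have h3 := hq p (by omega)
  refine le_trans ?_ h3.le
  have h0 : 0 < rho := by linarith [rho1]
  unfold lamf
  have hp1 : (1:ℝ) ≤ p := by exact_mod_cast (by omega : 1 ≤ p)
  have e1 : Real.sqrt (Real.log p) ≤ p := by
    rw [Real.sqrt_le_left (by linarith)]
    have := Real.log_le_self (by linarith : (0:ℝ) ≤ p)
    nlinarith
  have e2 : (2:ℝ) ^ p = rho ^ (8 * p) := by rw [pow_mul, rho8]
  rw [e2, pow_one]
  have e3 : rho ^ (2 * (j + r)) * rho ^ p ≤ rho ^ (8 * p) := by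
    rw [← pow_add]
    exact pow_le_pow_right₀ rho1.le (by omega)
  rw [div_le_div_iff₀ (by positivity) (by positivity)]
  calc _ = Real.sqrt (Real.log p) * (rho ^ (2 * (j + r)) * rho ^ p) := by ring
    _ ≤ p * rho ^ (8 * p) := by gcongr

/-- one exponential term -/
lemma one_term (ξ A B : ℝ) (hξ : 0 < ξ) (hA : 1 < A) (hAB : B - A = 1) : ∃ K : ℝ, 0 < K ∧ ∃ C : ℝ, 0 < C ∧ 
    ∃ H : ℕ, 1 ≤ H ∧ ∃ p0 : ℕ, 2 ≤ p0 ∧ 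
    ∀ (s : ℕ → ℕ), StrictMono s → (∀ n, 1 ≤ n → 1 ≤ s n) → ∀ p, p0 ≤ p → ∀ r < p, ∀ j < 2 * p + 1, 
    ∀ (g g' : ℝ → ℝ), Cls r g g' → ∀ l : ℕ,
    ∫ x in A..B, Real.exp (lamf p j r / (H * (r + 1)) * 
      ((∑ n ∈ Finset.Ioc (l * 2 ^ (2 * p - j)) ((l + 1) * 2 ^ (2 * p - j)), g (ξ * x ^ s n)) - thr K p (j + r))) ≤
      C * (1 / p ^ 5 * (1 / 4) ^ (j + r)) := by
  obtain ⟨C, hC, H, hH, l0, hl0, hmom⟩ := momI ξ A B hξ hA hAB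
  obtain ⟨K0, hK0, hpoly⟩ := rho_poly
  obtain ⟨q, hq⟩ := lam_small l0 hl0
  have hr0 : 0 < rho := by linarith [rho1]
  have hHR : (1:ℝ) ≤ H := by exact_mod_cast hH
  refine ⟨H * (C + 5) * K0, by positivity, C, by linarith, H, hH, q + 2, by omega, ?_⟩
  intro s hs hs1 p hp r hr j hj g g' hg l
  set K : ℝ := H * (C + 5) * K0 with hK
  have hlam := hq p (by omega) r hr j hj
  have hlam0 : 0 ≤ lamf p j r := by unfold lamf; positivity
  set I := Finset.Ioc (l * 2 ^ (2 * p - j)) ((l + 1) * 2 ^ (2 * p - j)) with hI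
  have hIc : I.card = 2 ^ (2 * p - j) := by
    rw [hI, Nat.card_Ioc, add_mul, one_mul, Nat.add_sub_cancel_left]
  have hm := hmom s hs hs1 r g g' hg (lamf p j r) hlam0 hlam I (fun m hm => by
    have := (Finset.mem_Ioc.1 hm).1; omega)
  set c := lamf p j r / (H * (r + 1)) with hc
  set L := Real.log p with hL
  have hp2 : (2:ℝ) ≤ p := by exact_mod_cast (by omega : 2 ≤ p)
  have hL0 : 0 < L := Real.log_pos (by linarith)
  -- exponent computations
  have e1 : lamf p j r ^ 2 * (1/2) ^ r * I.card ≤ L := by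
    have f1 : ((I.card : ℕ):ℝ) * 2 ^ j = (2 ^ p) ^ 2 := by
      rw [hIc]; push_cast; rw [← pow_add, ← pow_mul]; congr 1; omega
    have f2 : lamf p j r ^ 2 * (2 ^ p) ^ 2 = rho ^ (4 * (j + r)) * L := by
      unfold lamf
      rw [div_pow, div_mul_cancel₀ _ (by positivity), mul_pow, Real.sq_sqrt hL0.le, ← pow_mul]
      congr 2; ring
    have f3 : rho ^ (4 * (j + r)) ≤ 2 ^ (j + r) := by
      rw [← rho8, ← pow_mul]
      exact pow_le_pow_right₀ rho1.le (by omega)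
    have f4 : (lamf p j r ^ 2 * (1/2) ^ r * I.card) * 2 ^ (j + r) = rho ^ (4 * (j + r)) * L := by
      rw [← f2, ← f1, pow_add]
      have : (1/2:ℝ) ^ r * 2 ^ r = 1 := by rw [← mul_pow]; norm_num
      calc _ = lamf p j r ^ 2 * (I.card * 2 ^ j) * ((1/2:ℝ) ^ r * 2 ^ r) := by ring
        _ = _ := by rw [this]; ring
    have h2 : (0:ℝ) < 2 ^ (j + r) := by positivity
    refine le_of_mul_le_mul_right ?_ h2
    rw [f4, mul_comm L]
    gcongr
  have e2 : (C + 2 * (j + r : ℕ) + 5) * L ≤ c * thr K p (j + r) := by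
    have f1 : c * thr K p (j + r) = (K * rho ^ (j + r) / (H * (r + 1))) * L := by
      rw [hc]; unfold lamf thr
      have : rho ^ (2 * (j + r)) = rho ^ (j + r) * rho ^ (j + r) := by rw [← pow_add]; congr 1; ring
      rw [this]
      have hss : Real.sqrt L * Real.sqrt L = L := Real.mul_self_sqrt hL0.le
      rw [← hL]
      have : (0:ℝ) < rho ^ (j + r) := by positivity
      field_simp
      rw [Real.sq_sqrt hL0.le]
      ring
    rw [f1]
    refine mul_le_mul_of_nonneg_right ?_ hL0.le
    rw [le_div_iff₀ (by positivity)]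
    have f2 := hpoly (j + r)
    set m := j + r with hm
    have f3 : (r:ℝ) + 1 ≤ (m:ℝ) + 1 := by rw [hm]; push_cast; linarith [(Nat.cast_nonneg j : (0:ℝ) ≤ j)]
    have f4 : C + 2 * (m:ℝ) + 5 ≤ (C + 5) * ((m:ℝ) + 1) := by nlinarith [(Nat.cast_nonneg m : (0:ℝ) ≤ m)]
    calc (C + 2 * (m:ℝ) + 5) * (H * (r + 1)) ≤ ((C + 5) * ((m:ℝ) + 1)) * (H * ((m:ℝ) + 1)) := by gcongr
      _ = H * (C + 5) * ((m:ℝ) + 1) ^ 2 := by ring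
      _ ≤ H * (C + 5) * (K0 * rho ^ m) := by gcongr
      _ = _ := by rw [hK]; ring
  have e3 : ∀ x : ℝ, Real.exp (c * ((∑ n ∈ I, g (ξ * x ^ s n)) - thr K p (j + r))) = 
      Real.exp (c * (∑ n ∈ I, g (ξ * x ^ s n))) * Real.exp (- (c * thr K p (j + r))) := by
    intro x; rw [← Real.exp_add]; congr 1; ring
  simp only [e3]
  rw [intervalIntegral.integral_mul_const]
  calc _ ≤ C * Real.exp (C * lamf p j r ^ 2 * (1/2) ^ r * I.card) * Real.exp (- (c * thr K p (j + r))) := by gcongr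
    _ = C * Real.exp (C * (lamf p j r ^ 2 * (1/2) ^ r * I.card) - (c * thr K p (j + r))) := by
        rw [mul_assoc, ← Real.exp_add]; congr 2; ring
    _ ≤ C * Real.exp (C * L - (C + 2 * (j + r : ℕ) + 5) * L) := by gcongr
    _ = C * (1 / p ^ 5 * (1 / p ^ 2) ^ (j + r)) := by
        congr 1
        have : C * L - (C + 2 * (j + r : ℕ) + 5) * L = - ((5 + 2 * (j + r) : ℕ) * L) := by push_cast; ring
        rw [this, Real.exp_neg, Real.exp_nat_mul, hL, Real.exp_log (by linarith), pow_add, pow_mul]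
        rw [one_div_pow, mul_inv, one_div, one_div]
    _ ≤ _ := by
        gcongr
        nlinarith

lemma good (ξ A B : ℝ) (hξ : 0 < ξ) (hA : 1 < A) (hAB : B - A = 1) : ∃ K : ℝ, 0 < K ∧ 
    ∀ (s : ℕ → ℕ), StrictMono s → (∀ n, 1 ≤ n → 1 ≤ s n) → 
    ∀ᵐ x : ℝ ∂volume, x ∈ Set.Icc A B → ∀ᶠ p : ℕ in atTop, ∀ r < p, ∀ j < 2 * p + 1, 
      ∀ k < 2 ^ (r + 3), ∀ i < 8, ∀ l < 2 ^ j,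
      |∑ n ∈ Finset.Ioc (l * 2 ^ (2 * p - j)) ((l + 1) * 2 ^ (2 * p - j)), gf r k i (ξ * x ^ s n)| ≤ thr K p (j + r) := by
  obtain ⟨K, hK, C, hC, H, hH, p0, hp0, hterm⟩ := one_term ξ A B hξ hA hAB
  refine ⟨K, hK, fun s hs hs1 => ?_⟩
  have hr0 : 0 < rho := by linarith [rho1]
  have hHR : (1:ℝ) ≤ H := by exact_mod_cast hH
  set tm : ℝ → ℕ → ℕ → ℕ → ℕ → ℕ → ℕ → ℝ → ℝ := fun e p r j k i l x => 
    Real.exp (lamf p j r / (H * (r + 1)) * 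
      ((∑ n ∈ Finset.Ioc (l * 2 ^ (2 * p - j)) ((l + 1) * 2 ^ (2 * p - j)), e * gf r k i (ξ * x ^ s n)) - thr K p (j + r))) with htm
  set Z : ℕ → ℝ → ℝ := fun p x => ∑ r ∈ Finset.range p, ∑ j ∈ Finset.range (2 * p + 1), 
    ∑ k ∈ Finset.range (2 ^ (r + 3)), ∑ i ∈ Finset.range 8, ∑ l ∈ Finset.range (2 ^ j), 
      (tm 1 p r j k i l x + tm (-1) p r j k i l x) with hZ
  have gc : ∀ r k i, i < 8 → Continuous (gf r k i) := fun r k i hi => (gf_cls r k i hi).choose_spec.cont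
  have gc' : ∀ r k (i : ℕ), i ∈ Finset.range 8 → Continuous (gf r k i) := fun r k i hi => gc r k i (Finset.mem_range.1 hi)
  have tc : ∀ e p r j k i l, i < 8 → Continuous (tm e p r j k i l) := by
    intro e p r j k i l hi
    have := gc r k i hi
    simp only [htm]; fun_prop
  have t0 : ∀ e p r j k i l x, 0 ≤ tm e p r j k i l x := fun _ _ _ _ _ _ _ _ => (Real.exp_pos _).le
  have tint : ∀ p r j k i l, p0 ≤ p → r < p → j < 2 * p + 1 → i < 8 → 
      ∫ x in A..B, (tm 1 p r j k i l x + tm (-1) p r j k i l x) ≤ 2 * C * (1 / p ^ 5 * (1 / 4) ^ (j + r)) := by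
    intro p r j k i l hp hr hj hi
    obtain ⟨g', hg⟩ := gf_cls r k i hi
    rw [intervalIntegral.integral_add ((tc _ _ _ _ _ _ _ hi).intervalIntegrable _ _) ((tc _ _ _ _ _ _ _ hi).intervalIntegrable _ _)]
    have h1 := hterm s hs hs1 p hp r hr j hj _ _ hg l
    have h2 := hterm s hs hs1 p hp r hr j hj _ _ hg.neg l
    simp only [htm, one_mul, neg_one_mul]
    linarith
  have Zc : ∀ p, Continuous (Z p) := by
    intro p
    simp only [hZ]
    refine continuous_finsetSum _ fun r _ => continuous_finsetSum _ fun j _ => continuous_finsetSum _ fun k _ => 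
      continuous_finsetSum _ fun i hi => continuous_finsetSum _ fun l _ => ?_
    exact (tc _ _ _ _ _ _ _ (Finset.mem_range.1 hi)).add (tc _ _ _ _ _ _ _ (Finset.mem_range.1 hi))
  have Z0 : ∀ p x, 0 ≤ Z p x := fun p x => Finset.sum_nonneg fun r _ => Finset.sum_nonneg fun j _ => 
    Finset.sum_nonneg fun k _ => Finset.sum_nonneg fun i _ => Finset.sum_nonneg fun l _ => add_nonneg (t0 _ _ _ _ _ _ _ _) (t0 _ _ _ _ _ _ _ _)
  have Zint : ∀ p, p0 ≤ p → ∫ x in A..B, Z p x ≤ 384 * C * (1 / (p:ℝ) ^ 2) := by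
    intro p hp
    have hpp : (2:ℝ) ≤ p := by exact_mod_cast (by omega : 2 ≤ p)
    have z1 : ∫ x in A..B, Z p x = ∑ r ∈ Finset.range p, ∑ j ∈ Finset.range (2 * p + 1), 
        ∑ k ∈ Finset.range (2 ^ (r + 3)), ∑ i ∈ Finset.range 8, ∑ l ∈ Finset.range (2 ^ j), 
        ∫ x in A..B, (tm 1 p r j k i l x + tm (-1) p r j k i l x) := by
      have ic : ∀ r j k i l, i ∈ Finset.range 8 → Continuous fun x => (tm 1 p r j k i l x + tm (-1) p r j k i l x) := 
        fun r j k i l hi => (tc _ _ _ _ _ _ _ (Finset.mem_range.1 hi)).add (tc _ _ _ _ _ _ _ (Finset.mem_range.1 hi))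
      simp only [hZ]
      rw [intervalIntegral.integral_finsetSum fun r _ => Continuous.intervalIntegrable 
        (continuous_finsetSum _ fun j _ => continuous_finsetSum _ fun k _ => continuous_finsetSum _ fun i hi => continuous_finsetSum _ fun l _ => ic r j k i l hi) _ _]
      refine Finset.sum_congr rfl fun r _ => ?_
      rw [intervalIntegral.integral_finsetSum fun j _ => Continuous.intervalIntegrable 
        (continuous_finsetSum _ fun k _ => continuous_finsetSum _ fun i hi => continuous_finsetSum _ fun l _ => ic r j k i l hi) _ _]
      refine Finset.sum_congr rfl fun j _ => ?_
      rw [intervalIntegral.integral_finsetSum fun k _ => Continuous.intervalIntegrable 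
        (continuous_finsetSum _ fun i hi => continuous_finsetSum _ fun l _ => ic r j k i l hi) _ _]
      refine Finset.sum_congr rfl fun k _ => ?_
      rw [intervalIntegral.integral_finsetSum fun i hi => Continuous.intervalIntegrable 
        (continuous_finsetSum _ fun l _ => ic r j k i l hi) _ _]
      refine Finset.sum_congr rfl fun i hi => ?_
      rw [intervalIntegral.integral_finsetSum fun l _ => Continuous.intervalIntegrable (ic r j k i l hi) _ _]
    rw [z1]
    calc _ ≤ ∑ r ∈ Finset.range p, ∑ j ∈ Finset.range (2 * p + 1), 
        ∑ k ∈ Finset.range (2 ^ (r + 3)), ∑ i ∈ Finset.range 8, ∑ l ∈ Finset.range (2 ^ j), 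
          2 * C * (1 / (p:ℝ) ^ 5 * (1 / 4) ^ (j + r)) := by
          refine Finset.sum_le_sum fun r hr => Finset.sum_le_sum fun j hj => Finset.sum_le_sum fun k hk => 
            Finset.sum_le_sum fun i hi => Finset.sum_le_sum fun l hl => ?_
          exact tint p r j k i l hp (Finset.mem_range.1 hr) (Finset.mem_range.1 hj) (Finset.mem_range.1 hi)
      _ ≤ ∑ r ∈ Finset.range p, ∑ j ∈ Finset.range (2 * p + 1), 128 * C * (1 / (p:ℝ) ^ 5) := by
          refine Finset.sum_le_sum fun r hr => Finset.sum_le_sum fun j hj => ?_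
          simp only [Finset.sum_const, Finset.card_range, nsmul_eq_mul]
          push_cast
          have w1 : (2:ℝ) ^ (j + r) * (1/4) ^ (j + r) ≤ 1 := by
            rw [← mul_pow]; exact pow_le_one₀ (by norm_num) (by norm_num)
          have w2 : 0 ≤ 128 * C * (1 / (p:ℝ) ^ 5) := by positivity
          calc _ = 128 * C * (1 / (p:ℝ) ^ 5) * ((2:ℝ) ^ (j + r) * (1/4) ^ (j + r)) := by
                rw [pow_add 2 r 3, pow_add 2 j r]; ring
            _ ≤ _ := mul_le_of_le_one_right w2 w1
      _ = p * (2 * p + 1) * (128 * C * (1 / (p:ℝ) ^ 5)) := by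
          simp; ring
      _ ≤ 3 * (p:ℝ) ^ 3 * (128 * C * (1 / (p:ℝ) ^ 5)) := by
          refine mul_le_mul_of_nonneg_right ?_ (by positivity)
          have q1 : 2 * (p:ℝ) + 1 ≤ 3 * (p:ℝ) ^ 2 := by nlinarith
          calc (p:ℝ) * (2 * p + 1) ≤ p * (3 * (p:ℝ) ^ 2) := by gcongr
            _ = _ := by ring
      _ = _ := by field_simp; ring
  have hsum : Summable fun p : ℕ => 384 * C * (1 / (p:ℝ) ^ 2) := 
    (Real.summable_one_div_nat_pow.2 (by norm_num)).mul_left _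
  have hbc := bc A B (by linarith) Z Zc Z0 _ hsum p0 Zint
  filter_upwards [hbc] with x hx hxI
  filter_upwards [hx hxI, eventually_ge_atTop 2] with p hp hp2 r hr j hj k hk i hi l hl
  have hpp : (2:ℝ) ≤ p := by exact_mod_cast hp2
  have hL0 : 0 < Real.log p := Real.log_pos (by linarith)
  have hs : tm 1 p r j k i l x + tm (-1) p r j k i l x ≤ 1 := by
    refine le_trans ?_ hp
    simp only [hZ]
    have nn : ∀ r j k i l, 0 ≤ tm 1 p r j k i l x + tm (-1) p r j k i l x := fun _ _ _ _ _ => 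
      add_nonneg (t0 _ _ _ _ _ _ _ _) (t0 _ _ _ _ _ _ _ _)
    refine le_trans ?_ (Finset.single_le_sum (fun r _ => Finset.sum_nonneg fun j _ => 
      Finset.sum_nonneg fun k _ => Finset.sum_nonneg fun i _ => Finset.sum_nonneg fun l _ => nn r j k i l) (Finset.mem_range.2 hr))
    refine le_trans ?_ (Finset.single_le_sum (fun j _ => 
      Finset.sum_nonneg fun k _ => Finset.sum_nonneg fun i _ => Finset.sum_nonneg fun l _ => nn r j k i l) (Finset.mem_range.2 hj))
    refine le_trans ?_ (Finset.single_le_sum (fun k _ => 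
      Finset.sum_nonneg fun i _ => Finset.sum_nonneg fun l _ => nn r j k i l) (Finset.mem_range.2 hk))
    refine le_trans ?_ (Finset.single_le_sum (fun i _ => 
      Finset.sum_nonneg fun l _ => nn r j k i l) (Finset.mem_range.2 hi))
    exact (Finset.single_le_sum (f := fun l => tm 1 p r j k i l x + tm (-1) p r j k i l x) (fun l _ => nn r j k i l) (Finset.mem_range.2 hl))
  have hc : 0 < lamf p j r / (H * (r + 1)) := by
    unfold lamf
    have := Real.sqrt_pos.2 hL0
    positivity
  have s1 : tm 1 p r j k i l x ≤ 1 := by linarith [t0 (-1) p r j k i l x]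
  have s2 : tm (-1) p r j k i l x ≤ 1 := by linarith [t0 1 p r j k i l x]
  simp only [htm, one_mul, neg_one_mul, Finset.sum_neg_distrib] at s1 s2
  rw [Real.exp_le_one_iff] at s1 s2
  have s1' := nonpos_of_mul_nonpos_right s1 hc
  have s2' := nonpos_of_mul_nonpos_right s2 hc
  rw [abs_le]; constructor <;> linarith


lemma smallDisc_nonneg (R N : ℕ) (z : ℕ → ℝ) : 0 ≤ smallDisc R N z := by
  unfold smallDisc
  apply Real.sSup_nonneg
  rintro d ⟨a, _, b, _, _, rfl⟩
  exact abs_nonneg _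

lemma discN (K : ℝ) (hK : 0 < K) (y : ℕ → ℝ) (R p N : ℕ) (hRp : R < p) (hN1 : 4 ^ (p - 1) ≤ N) (hN2 : N < 4 ^ p)
    (h : ∀ r < p, ∀ j < 2 * p + 1, ∀ k < 2 ^ (r + 3), ∀ i < 8, ∀ l < 2 ^ j,
      |∑ n ∈ Finset.Ioc (l * 2 ^ (2 * p - j)) ((l + 1) * 2 ^ (2 * p - j)), gf r k i (y n)| ≤ thr K p (j + r)) :
    Real.sqrt N * smallDisc R N (fun n => Int.fract (y n)) ≤
      24 * K * (1 / (1 - 1 / rho)) ^ 2 * (1 / rho) ^ R * Real.sqrt (Real.log p) + 10 := by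
  have hr1 := rho1
  have hr0 : 0 < rho := by linarith
  set b := 1 / rho with hb
  have hb0 : 0 < b := by positivity
  have hb1 : b < 1 := by rw [hb, div_lt_one hr0]; exact hr1
  set q := 1 / (1 - b) with hq
  have hq0 : 0 < q := by rw [hq]; have : 0 < 1 - b := by linarith
                         positivity
  set S := Real.sqrt (Real.log p) with hS
  have hS0 : 0 ≤ S := Real.sqrt_nonneg _
  have thrE : ∀ m, thr K p m = K * 2 ^ p * S * b ^ m := by
    intro m; unfold thr; rw [hb, one_div_pow]; ring
  have c1 : ∀ r, R ≤ r → r < p → ∀ k < 2 ^ (r + 3), ∀ i < 8, 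
      |∑ n ∈ Finset.Ioc 0 N, gf r k i (y n)| ≤ K * q * 2 ^ p * S * b ^ r := by
    intro r _ hr k hk i hi
    have := chainN (2 * p) (fun n => gf r k i (y n)) (fun j => thr K p (j + r)) 
      (fun j => by simp only [thrE]; positivity) (fun j hj l hl => h r hr j (by omega) k hk i hi l hl) N
      (by rw [pow_mul]; norm_num; exact hN2)
    refine this.trans ?_
    have e : ∀ j, thr K p (j + r) = K * 2 ^ p * S * b ^ r * b ^ j := by
      intro j; rw [thrE, pow_add]; ring
    simp only [e]
    rw [← Finset.mul_sum]
    calc _ ≤ K * 2 ^ p * S * b ^ r * q := by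
            gcongr; exact geom_fin b hb0.le hb1 _
      _ = _ := by ring
  have c2 := detBound p R N hRp y (fun r => K * q * 2 ^ p * S * b ^ r) (fun j => by positivity) c1
  have c3 : ∑ r ∈ Finset.Ico R p, K * q * 2 ^ p * S * b ^ r ≤ K * q ^ 2 * 2 ^ p * S * b ^ R := by
    rw [Finset.sum_Ico_eq_sum_range]
    simp only [pow_add b R]
    have e : ∀ j, K * q * 2 ^ p * S * (b ^ R * b ^ j) = K * q * 2 ^ p * S * b ^ R * b ^ j := by intro j; ring
    simp only [e]
    rw [← Finset.mul_sum]
    calc _ ≤ K * q * 2 ^ p * S * b ^ R * q := by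
            gcongr; exact geom_fin b hb0.le hb1 _
      _ = _ := by ring
  have hNpos : (0:ℝ) < N := by
    have : 0 < 4 ^ (p - 1) := by positivity
    exact_mod_cast (by omega : 0 < N)
  set w := Real.sqrt N with hw
  have hw0 : 0 < w := Real.sqrt_pos.2 hNpos
  have hww : w * w = N := Real.mul_self_sqrt hNpos.le
  have d1 : (2:ℝ) ^ p ≤ 2 * w := by
    have : (2:ℝ) ^ (p - 1) ≤ w := by
      apply Real.le_sqrt_of_sq_le
      rw [← pow_mul, mul_comm, pow_mul]; norm_num; exact_mod_cast hN1
    have e : (2:ℝ) ^ p = 2 * 2 ^ (p - 1) := by rw [← pow_succ']; congr 1; omega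
    rw [e]; linarith
  have d2 : w * (1/2) ^ p ≤ 1 := by
    have : w ≤ (2:ℝ) ^ p := by
      rw [hw, Real.sqrt_le_left (by positivity), ← pow_mul, mul_comm, pow_mul]
      norm_num; exact_mod_cast hN2.le
    rw [one_div_pow, mul_one_div, div_le_one (by positivity)]; exact this
  calc w * smallDisc R N (fun n => Int.fract (y n)) 
      ≤ w * ((12 * (K * q ^ 2 * 2 ^ p * S * b ^ R) + 10 * (1/2) ^ p * N) / N) := by
        refine mul_le_mul_of_nonneg_left (c2.trans ?_) hw0.le
        gcongr
    _ = 12 * K * q ^ 2 * S * b ^ R * (2 ^ p / w) + 10 * (w * (1/2) ^ p) := by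
        rw [← hww]; field_simp
    _ ≤ 12 * K * q ^ 2 * S * b ^ R * 2 + 10 * 1 := by
        gcongr
        rw [div_le_iff₀ hw0]; exact d1
    _ = _ := by ring

lemma log_cmp (p N : ℕ) (hp : 3 ≤ p) (hN1 : 4 ^ (p - 1) ≤ N) :
    Real.sqrt (Real.log p) ≤ 2 * Real.sqrt (plog (plog N)) := by
  have h4 : (1:ℝ) ≤ Real.log 4 := by
    rw [show (4:ℝ) = 2 ^ 2 by norm_num, Real.log_pow]; push_cast
    linarith [Real.log_two_gt_d9]
  obtain ⟨t, rfl⟩ : ∃ t, p = t + 1 := ⟨p - 1, by omega⟩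
  simp only [Nat.add_sub_cancel] at hN1
  have ht : (2:ℝ) ≤ t := by exact_mod_cast (by omega : 2 ≤ t)
  have h1 : (t:ℝ) ≤ plog N := by
    refine le_trans ?_ (le_max_right _ _)
    calc (t:ℝ) ≤ t * Real.log 4 := by nlinarith
      _ = Real.log (4 ^ t) := by rw [Real.log_pow]
      _ ≤ _ := Real.log_le_log (by positivity) (by exact_mod_cast hN1)
  have h2 : Real.log t ≤ plog (plog N) := 
    le_trans (Real.log_le_log (by linarith) h1) (le_max_right _ _)
  have h3 : Real.log ((t + 1 : ℕ):ℝ) ≤ 2 * Real.log t := by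
    rw [← Real.log_rpow (by linarith)]
    apply Real.log_le_log (by positivity)
    push_cast; norm_num; nlinarith
  have h0 : 0 ≤ plog (plog N) := le_trans zero_le_one (le_max_left _ _)
  rw [Real.sqrt_le_left (by positivity), mul_pow, Real.sq_sqrt h0]
  linarith

theorem stmt13 (ξ A B : ℝ) (hξ : 0 < ξ) (hA : 1 < A) (hAB : B - A = 1) :
    ∃ c : ℝ, 0 < c ∧
      ∀ s : ℕ → ℕ, StrictMono s → (∀ n, 1 ≤ n → 1 ≤ s n) →
      ∀ R : ℕ, 1 ≤ R →
        ∀ᵐ x : ℝ ∂volume, x ∈ Set.Icc A B →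
          Filter.atTop.limsup (fun N : ℕ =>
              Real.sqrt N * smallDisc R N (fun n => Int.fract (ξ * x ^ s n)) /
                Real.sqrt (plog (plog N))) ≤ c / R := by
  obtain ⟨K, hK, hgood⟩ := good ξ A B hξ hA hAB
  obtain ⟨K0, hK0, hpoly⟩ := rho_poly
  have hr1 := rho1
  have hr0 : 0 < rho := by linarith
  set q := 1 / (1 - 1 / rho) with hq
  refine ⟨2 * (24 * K * q ^ 2 + 1) * K0, by positivity, fun s hs hs1 R hR => ?_⟩
  filter_upwards [hgood s hs hs1] with x hx hxI
  have hx := hx hxI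
  have hRpos : (1:ℝ) ≤ R := by exact_mod_cast hR
  have hbR : 0 < (1 / rho) ^ R := by positivity
  have hlog : ∀ᶠ p : ℕ in atTop, 10 / (1 / rho) ^ R ≤ Real.sqrt (Real.log p) :=
    (Real.tendsto_sqrt_atTop.comp (Real.tendsto_log_atTop.comp tendsto_natCast_atTop_atTop)).eventually_ge_atTop _
  obtain ⟨p1, hp1⟩ := eventually_atTop.1 (hx.and hlog)
  have hbR2 : (1 / rho) ^ R ≤ K0 / R := by
    rw [one_div_pow, div_le_div_iff₀ (by positivity) (by linarith)]
    have := hpoly R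
    nlinarith
  have key : ∀ᶠ N : ℕ in atTop, Real.sqrt N * smallDisc R N (fun n => Int.fract (ξ * x ^ s n)) /
                Real.sqrt (plog (plog N)) ≤ 2 * (24 * K * q ^ 2 + 1) * K0 / R := by
    filter_upwards [eventually_ge_atTop (4 ^ (p1 + R + 3))] with N hN
    have hN0 : N ≠ 0 := by have : 0 < 4 ^ (p1 + R + 3) := by positivity
                           omega
    obtain ⟨p, hp⟩ : ∃ p, p = Nat.log 4 N + 1 := ⟨_, rfl⟩
    have hpl : p1 + R + 3 ≤ Nat.log 4 N := Nat.le_log_of_pow_le (by norm_num) hN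
    have hN1 : 4 ^ (p - 1) ≤ N := by rw [hp]; exact Nat.pow_log_le_self 4 hN0
    have hN2 : N < 4 ^ p := by rw [hp]; exact Nat.lt_pow_succ_log_self (by norm_num) N
    obtain ⟨g1, g2⟩ := hp1 p (by omega)
    have d := discN K hK (fun n => ξ * x ^ s n) R p N (by omega) hN1 hN2 g1
    have lc := log_cmp p N (by omega) hN1
    have h0 : 1 ≤ plog (plog N) := le_max_left _ _
    rw [div_le_iff₀ (Real.sqrt_pos.2 (by linarith))]
    rw [div_le_iff₀ hbR] at g2
    calc _ ≤ _ := d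
      _ ≤ (24 * K * q ^ 2 + 1) * ((1 / rho) ^ R * Real.sqrt (Real.log p)) := by rw [← hq]; nlinarith
      _ ≤ (24 * K * q ^ 2 + 1) * (K0 / R * (2 * Real.sqrt (plog (plog N)))) := by gcongr
      _ = _ := by ring
  refine Filter.limsup_le_of_le ?_ key
  refine isCoboundedUnder_le_of_le atTop (x := 0) fun N => ?_
  have := smallDisc_nonneg R N (fun n => Int.fract (ξ * x ^ s n))
  positivity
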